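/- arXiv:2604.08887 — 9 statements merged into one kernel-verified Lean document; each statement's English description precedes it below -/
import Mathlib

section
/- Let ν⁽ⁿ⁾ (n ≥ 1) be Borel probability measures on [0,∞) converging vaguely to a sub-probability measure ν, and let f⁽ⁿ⁾, f : [0,∞) → ℝ be Borel measurable functions such that f is bounded, left-continuous with right limits, has only finitely many discontinuity points in every bounded interval, and sup_{u ∈ [0,∞)} |f⁽ⁿ⁾(u) − f(u)| → 0 as n → ∞. Then for all real numbers 0 ≤ x < y < ∞, ∫_{(x,y]} f⁽ⁿ⁾(u) dν⁽ⁿ⁾(u) → ∫_{(x,y]} f(u) dν(u) as n → ∞. -/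
open MeasureTheory Filter Set

/-- A function bounded on `[0,∞)` is integrable on every `(a,b]` with `0 ≤ a`. -/
lemma integrableOn_Ioc_of_bounded_on_Ici {μ : Measure ℝ} [IsFiniteMeasure μ] {f : ℝ → ℝ}
    (hf : Measurable f) {M : ℝ} (hM : ∀ u ∈ Ici (0 : ℝ), |f u| ≤ M) {a b : ℝ} (ha : 0 ≤ a) :
    IntegrableOn f (Ioc a b) μ := by
  refine Measure.integrableOn_of_bounded (M := M) (measure_ne_top _ _) hf.aestronglyMeasurable ?_
  filter_upwards [ae_restrict_mem measurableSet_Ioc] with u hu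
  exact hM u (ha.trans hu.1.le)

/-- Functions that are uniformly close on a set have close integrals over it. -/
lemma abs_setIntegral_sub_setIntegral_le {μ : Measure ℝ} [IsFiniteMeasure μ] {f g : ℝ → ℝ}
    {s : Set ℝ} (hf : IntegrableOn f s μ) (hg : IntegrableOn g s μ) {ε : ℝ}
    (h : ∀ u ∈ s, |f u - g u| ≤ ε) :
    |∫ u in s, f u ∂μ - ∫ u in s, g u ∂μ| ≤ ε * μ.real s := by
  rw [← integral_sub hf hg]
  exact norm_setIntegral_le_of_norm_le_const (f := fun u => f u - g u) (measure_lt_top _ _) h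

/-- Up to errors proportional to the masses of `(a,b]`, the integrals of `f` over `(a,b]`
with respect to `ν n` and `νlim` are a convergent sequence and its limit. -/
def ApproxConvOn (ν : ℕ → Measure ℝ) (νlim : Measure ℝ) (f : ℝ → ℝ) (ε a b : ℝ) : Prop :=
  ∃ (c : ℕ → ℝ) (L : ℝ), Tendsto c atTop (nhds L) ∧
    (∀ n, |∫ u in Ioc a b, f u ∂(ν n) - c n| ≤ ε * (ν n).real (Ioc a b)) ∧
    |∫ u in Ioc a b, f u ∂νlim - L| ≤ ε * νlim.real (Ioc a b)

section ApproxConvOn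

variable {ν : ℕ → Measure ℝ} {νlim : Measure ℝ} {f : ℝ → ℝ} {ε : ℝ}

lemma ApproxConvOn.refl (a : ℝ) : ApproxConvOn ν νlim f ε a a :=
  ⟨fun _ => 0, 0, tendsto_const_nhds, by simp, by simp⟩

variable [∀ n, IsFiniteMeasure (ν n)] [IsFiniteMeasure νlim]

lemma ApproxConvOn.trans {a b c : ℝ}
    (h₁ : ApproxConvOn ν νlim f ε a b) (h₂ : ApproxConvOn ν νlim f ε b c)
    (hab : a ≤ b) (hbc : b ≤ c)
    (hint : ∀ n, IntegrableOn f (Ioc a c) (ν n)) (hintlim : IntegrableOn f (Ioc a c) νlim) :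
    ApproxConvOn ν νlim f ε a c := by
  obtain ⟨s, S, hs, hsn, hsl⟩ := h₁
  obtain ⟨t, T, ht, htn, htl⟩ := h₂
  have key : ∀ (μ : Measure ℝ) [IsFiniteMeasure μ], IntegrableOn f (Ioc a c) μ → ∀ p q : ℝ,
      |∫ u in Ioc a b, f u ∂μ - p| ≤ ε * μ.real (Ioc a b) →
      |∫ u in Ioc b c, f u ∂μ - q| ≤ ε * μ.real (Ioc b c) →
      |∫ u in Ioc a c, f u ∂μ - (p + q)| ≤ ε * μ.real (Ioc a c) := by
    intro μ _ hμ p q hp hq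
    have hd : Disjoint (Ioc a b) (Ioc b c) := Ioc_disjoint_Ioc_of_le le_rfl
    rw [← Ioc_union_Ioc_eq_Ioc hab hbc] at hμ ⊢
    rw [setIntegral_union hd measurableSet_Ioc hμ.left_of_union hμ.right_of_union,
      measureReal_union hd measurableSet_Ioc, mul_add, add_sub_add_comm]
    exact (abs_add_le _ _).trans (add_le_add hp hq)
  exact ⟨fun n => s n + t n, S + T, hs.add ht,
    fun n => key _ (hint n) _ _ (hsn n) (htn n), key _ hintlim _ _ hsl htl⟩

lemma ApproxConvOn.of_near_const {a b l : ℝ} (h : ∀ u ∈ Ioc a b, |f u - l| ≤ ε)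
    (hν : Tendsto (fun n => (ν n).real (Ioc a b)) atTop (nhds (νlim.real (Ioc a b))))
    (hint : ∀ n, IntegrableOn f (Ioc a b) (ν n)) (hintlim : IntegrableOn f (Ioc a b) νlim) :
    ApproxConvOn ν νlim f ε a b := by
  have key : ∀ (μ : Measure ℝ) [IsFiniteMeasure μ], IntegrableOn f (Ioc a b) μ →
      |∫ u in Ioc a b, f u ∂μ - μ.real (Ioc a b) * l| ≤ ε * μ.real (Ioc a b) := by
    intro μ _ hμ
    have := abs_setIntegral_sub_setIntegral_le hμ (integrableOn_const (C := l)) h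
    rwa [setIntegral_const, smul_eq_mul] at this
  exact ⟨fun n => (ν n).real (Ioc a b) * l, νlim.real (Ioc a b) * l, hν.mul_const l,
    fun n => key _ (hint n), key _ hintlim⟩

/-- A bounded function with one-sided limits, left-continuous on `(0,∞)`, has approximately
convergent integrals along a vaguely convergent sequence, at every precision `ε`. -/
lemma ApproxConvOn.of_vague
    (hvague : ∀ a b : ℝ, 0 ≤ a → a < b →
      Tendsto (fun n => (ν n).real (Ioc a b)) atTop (nhds (νlim.real (Ioc a b))))
    (hf_meas : Measurable f) {M : ℝ} (hM : ∀ u ∈ Ici (0 : ℝ), |f u| ≤ M)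
    (hleft : ∀ x : ℝ, 0 < x → Tendsto f (nhdsWithin x (Iio x)) (nhds (f x)))
    (hright : ∀ x ∈ Ici (0 : ℝ), ∃ l : ℝ, Tendsto f (nhdsWithin x (Ioi x)) (nhds l))
    (hε : 0 < ε) {x y : ℝ} (hx : 0 ≤ x) (hxy : x ≤ y) :
    ApproxConvOn ν νlim f ε x y := by
  have hconst : ∀ {a b l : ℝ}, 0 ≤ a → a < b → (∀ u ∈ Ioc a b, |f u - l| ≤ ε) →
      ApproxConvOn ν νlim f ε a b := fun ha hab h =>
    .of_near_const h (hvague _ _ ha hab)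
      (fun _ => integrableOn_Ioc_of_bounded_on_Ici hf_meas hM ha)
      (integrableOn_Ioc_of_bounded_on_Ici hf_meas hM ha)
  have htrans : ∀ {b c : ℝ}, x ≤ b → b ≤ c → ApproxConvOn ν νlim f ε x b →
      ApproxConvOn ν νlim f ε b c → ApproxConvOn ν νlim f ε x c := fun hb hc h₁ h₂ =>
    h₁.trans h₂ hb hc
      (fun _ => integrableOn_Ioc_of_bounded_on_Ici hf_meas hM hx)
      (integrableOn_Ioc_of_bounded_on_Ici hf_meas hM hx)
  set S : Set ℝ := {z | z ∈ Icc x y ∧ ApproxConvOn ν νlim f ε x z}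
  have hxS : x ∈ S := ⟨⟨le_rfl, hxy⟩, .refl x⟩
  have hbdd : BddAbove S := ⟨y, fun z hz => hz.1.2⟩
  set c := sSup S
  have hxc : x ≤ c := le_csSup hbdd hxS
  have hcy : c ≤ y := csSup_le ⟨x, hxS⟩ fun z hz => hz.1.2
  have hcS : ApproxConvOn ν νlim f ε x c := by
    rcases hxc.eq_or_lt with h | h
    · rw [← h]; exact .refl x
    obtain ⟨d, hd, hdc⟩ := (mem_nhdsLT_iff_exists_Ioo_subset).1
      ((hleft c (hx.trans_lt h)).eventually (Metric.closedBall_mem_nhds (f c) hε))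
    obtain ⟨z, hzS, hz⟩ := exists_lt_of_lt_csSup ⟨x, hxS⟩ hd
    have hzc : z ≤ c := le_csSup hbdd hzS
    rcases hzc.eq_or_lt with hzlt | hzlt
    · rw [← hzlt]; exact hzS.2
    refine htrans hzS.1.1 hzc hzS.2 (hconst (l := f c) (hx.trans hzS.1.1) hzlt fun u hu => ?_)
    rcases hu.2.eq_or_lt with huc | huc
    · simp [huc, hε.le]
    · exact hdc ⟨hz.trans hu.1, huc⟩
  rcases hcy.eq_or_lt with h | h
  · rwa [← h]
  obtain ⟨l, hl⟩ := hright c (hx.trans hxc)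
  obtain ⟨d, hd, hdc⟩ := (mem_nhdsGT_iff_exists_Ioo_subset).1
    (hl.eventually (Metric.closedBall_mem_nhds l hε))
  obtain ⟨z, hcz, hz⟩ := exists_between (lt_min hd h)
  have hzS : z ∈ S := ⟨⟨hxc.trans hcz.le, (hz.trans_le (min_le_right _ _)).le⟩,
    htrans hxc hcz.le hcS (hconst (l := l) (hx.trans hxc) hcz fun u hu =>
      hdc ⟨hu.1, hu.2.trans_lt (hz.trans_le (min_le_left _ _))⟩)⟩
  exact absurd (le_csSup hbdd hzS) hcz.not_ge

end ApproxConvOn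

/-- Lemma 2.5 (`limit-hbn`): if probability measures `ν n` on `[0,∞)` converge vaguely
to a sub-probability measure `ν`, and `fn` converges uniformly on `[0,∞)` to a bounded,
left-continuous function `f` with right limits and only finitely many discontinuity
points in every bounded interval, then `∫_{(x,y]} fn dν_n → ∫_{(x,y]} f dν`. -/
theorem stmt1
    (ν : ℕ → Measure ℝ) (νlim : Measure ℝ)
    [∀ n, IsProbabilityMeasure (ν n)]
    (hsupp : ∀ n, ν n (Iio 0) = 0)
    (hsub : νlim univ ≤ 1) (hsupplim : νlim (Iio 0) = 0)
    (hvague : ∀ a b : ℝ, 0 ≤ a → a < b →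
      Tendsto (fun n => ((ν n) (Ioc a b)).toReal) atTop (nhds ((νlim (Ioc a b)).toReal)))
    (f : ℝ → ℝ) (fn : ℕ → ℝ → ℝ)
    (hfn_meas : ∀ n, Measurable (fn n)) (hf_meas : Measurable f)
    (hf_bdd : ∃ M : ℝ, ∀ u ∈ Ici (0:ℝ), |f u| ≤ M)
    (hf_leftcont : ∀ x : ℝ, 0 < x → Tendsto f (nhdsWithin x (Iio x)) (nhds (f x)))
    (hf_rightlim : ∀ x ∈ Ici (0:ℝ), ∃ l : ℝ, Tendsto f (nhdsWithin x (Ioi x)) (nhds l))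
    (hf_disc : ∀ M : ℝ, {u : ℝ | u ∈ Icc (0:ℝ) M ∧ ¬ ContinuousWithinAt f (Ici 0) u}.Finite)
    (hconv : TendstoUniformlyOn fn f atTop (Ici 0)) :
    ∀ x y : ℝ, 0 ≤ x → x < y →
      Tendsto (fun n => ∫ u in Ioc x y, fn n u ∂(ν n)) atTop
        (nhds (∫ u in Ioc x y, f u ∂νlim)) := by
  intro x y hx hxy
  have : IsFiniteMeasure νlim := ⟨hsub.trans_lt ENNReal.one_lt_top⟩
  obtain ⟨M, hM⟩ := hf_bdd
  have hmass : νlim.real (Ioc x y) ≤ 1 :=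
    ENNReal.toReal_le_of_le_ofReal zero_le_one
      (by simpa using (measure_mono (subset_univ _)).trans hsub)
  rw [Metric.tendsto_nhds]
  intro δ hδ
  have hε : 0 < δ / 4 := by positivity
  obtain ⟨c, L, hcL, hcn, hL⟩ := ApproxConvOn.of_vague (ν := ν) (νlim := νlim) hvague hf_meas hM
    hf_leftcont hf_rightlim hε hx hxy.le
  filter_upwards [Metric.tendstoUniformlyOn_iff.1 hconv _ hε,
    hcL.eventually (Metric.ball_mem_nhds L hε)] with n hn hnL
  have hfnf : ∀ u ∈ Ici (0 : ℝ), |fn n u - f u| ≤ δ / 4 := fun u hu => by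
    rw [abs_sub_comm]; exact (hn u hu).le
  have hfnM : ∀ u ∈ Ici (0 : ℝ), |fn n u| ≤ δ / 4 + M := fun u hu => by
    have := abs_add_le (fn n u - f u) (f u)
    rw [sub_add_cancel] at this
    linarith [hfnf u hu, hM u hu]
  have h₁ := abs_setIntegral_sub_setIntegral_le (μ := ν n) (s := Ioc x y)
    (integrableOn_Ioc_of_bounded_on_Ici (hfn_meas n) hfnM hx)
    (integrableOn_Ioc_of_bounded_on_Ici hf_meas hM hx)
    (fun u hu => hfnf u (hx.trans hu.1.le))
  have h₂ := hcn n
  have h₃ : |c n - L| < δ / 4 := hnL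
  have hmassn := mul_le_of_le_one_right hε.le (measureReal_le_one (μ := ν n) (s := Ioc x y))
  have hmasslim := mul_le_of_le_one_right hε.le hmass
  rw [Real.dist_eq]
  rw [abs_le] at h₁ h₂ hL
  rw [abs_lt] at h₃ ⊢
  constructor <;> linarith [h₁.1, h₁.2, h₂.1, h₂.2, hL.1, hL.2, h₃.1, h₃.2]
end

section
/- For every n ≥ 1 and every θ ∈ ℝ there is a unique real number η = η⁽ⁿ⁾(θ) satisfying e^{θ}·E[e^{−η·(T ∧ n^{1/2})}] = 1. Moreover, for each fixed θ ∈ ℝ, n·(η⁽ⁿ⁾(n^{−1/2}θ) − n^{−1/2}θ) → (σ²/2)·θ² as n → ∞; that is, η⁽ⁿ⁾(n^{−1/2}θ) = n^{−1/2}θ + (σ²/2)·n^{−1}θ² + o(n^{−1}). -/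
open MeasureTheory Filter

/-- The expectation of an almost surely positive integrable random variable is positive. -/
theorem integral_pos_of_ae_pos {Ω : Type*} [MeasurableSpace Ω] {μ : Measure Ω}
    [IsProbabilityMeasure μ] {f : Ω → ℝ} (hf : Integrable f μ) (hpos : ∀ᵐ ω ∂μ, 0 < f ω) :
    0 < ∫ ω, f ω ∂μ := by
  rw [integral_pos_iff_support_of_nonneg_ae (hpos.mono fun ω h => h.le) hf]
  have hsupp : ∀ᵐ ω ∂μ, ω ∈ Function.support f := hpos.mono fun ω h => h.ne'
  have hone : μ (Function.support f) = μ Set.univ := measure_congr (eventuallyEq_univ.mpr hsupp)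
  simp [hone]

/-- The Laplace transform of a bounded, almost surely positive random variable is strictly
decreasing. -/
theorem strictAnti_integral_exp_neg_mul {Ω : Type*} [MeasurableSpace Ω] {μ : Measure Ω}
    [IsProbabilityMeasure μ] {X : Ω → ℝ} {c : ℝ} (hX : AEMeasurable X μ)
    (hpos : ∀ᵐ ω ∂μ, 0 < X ω) (hle : ∀ᵐ ω ∂μ, X ω ≤ c) :
    StrictAnti fun η : ℝ => ∫ ω, Real.exp (-η * X ω) ∂μ := by
  have hmem : ∀ᵐ ω ∂μ, X ω ∈ Set.Icc 0 c := by
    filter_upwards [hpos, hle] with ω h₁ h₂ using ⟨h₁.le, h₂⟩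
  have hint (t : ℝ) : Integrable (fun ω => Real.exp (t * X ω)) μ :=
    ProbabilityTheory.integrable_exp_mul_of_mem_Icc hX hmem
  intro x y hxy
  have hdiff : 0 < ∫ ω, (Real.exp (-x * X ω) - Real.exp (-y * X ω)) ∂μ := by
    refine integral_pos_of_ae_pos ((hint _).sub (hint _)) ?_
    filter_upwards [hpos] with ω hω
    rw [sub_pos, Real.exp_lt_exp]
    nlinarith
  rw [integral_sub (hint _) (hint _)] at hdiff
  exact sub_pos.mp hdiff

/-- The Laplace transform of a bounded, almost surely positive random variable takes every
positive value. -/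
theorem exists_integral_exp_neg_mul_eq {Ω : Type*} [MeasurableSpace Ω] {μ : Measure Ω}
    [IsProbabilityMeasure μ] {X : Ω → ℝ} {c : ℝ} (hX : AEMeasurable X μ)
    (hpos : ∀ᵐ ω ∂μ, 0 < X ω) (hle : ∀ᵐ ω ∂μ, X ω ≤ c) {y : ℝ} (hy : 0 < y) :
    ∃ η : ℝ, ∫ ω, Real.exp (-η * X ω) ∂μ = y := by
  have hmem : ∀ᵐ ω ∂μ, X ω ∈ Set.Icc 0 c := by
    filter_upwards [hpos, hle] with ω h₁ h₂ using ⟨h₁.le, h₂⟩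
  have hint (t : ℝ) : Integrable (fun ω => Real.exp (t * X ω)) μ :=
    ProbabilityTheory.integrable_exp_mul_of_mem_Icc hX hmem
  have hXint : Integrable X μ := Integrable.of_mem_Icc 0 c hX hmem
  have hXpos : 0 < ∫ ω, X ω ∂μ := integral_pos_of_ae_pos hXint hpos
  have hcont : Continuous fun η : ℝ => ∫ ω, Real.exp (-η * X ω) ∂μ :=
    (ProbabilityTheory.continuous_mgf hint).comp continuous_neg
  have hzero : Tendsto (fun η : ℝ => ∫ ω, Real.exp (-η * X ω) ∂μ) atTop (nhds 0) := by
    rw [← integral_zero Ω ℝ (μ := μ)]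
    refine tendsto_integral_filter_of_dominated_convergence (fun _ => 1)
      (.of_forall fun η => (hint _).aestronglyMeasurable) ?_ (integrable_const _) ?_
    · filter_upwards [eventually_ge_atTop 0] with η hη
      filter_upwards [hpos] with ω hω
      rw [Real.norm_eq_abs, Real.abs_exp, Real.exp_le_one_iff]
      nlinarith
    · filter_upwards [hpos] with ω hω
      exact Real.tendsto_exp_atBot.comp (tendsto_neg_atTop_atBot.atBot_mul_const hω)
  refine mem_range_of_exists_le_of_exists_ge hcont ?_ ⟨-(y / ∫ ω, X ω ∂μ), ?_⟩
  · exact ((hzero.eventually_lt_const hy).exists).imp fun _ h => h.le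
  · have hmono : ∫ ω, (y / ∫ ω, X ω ∂μ) * X ω ∂μ
        ≤ ∫ ω, Real.exp (-(-(y / ∫ ω, X ω ∂μ)) * X ω) ∂μ := by
      refine integral_mono (hXint.const_mul _) (hint _) fun ω => ?_
      rw [neg_neg]
      linarith [Real.add_one_le_exp ((y / ∫ ω, X ω ∂μ) * X ω)]
    rwa [integral_const_mul, div_mul_cancel₀ _ hXpos.ne'] at hmono

theorem abs_exp_sub_one_sub_id_le_sq_mul_exp_abs (x : ℝ) :
    |Real.exp x - 1 - x| ≤ x ^ 2 * Real.exp |x| := by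
  have h := Complex.norm_exp_sub_sum_le_norm_mul_exp (x : ℂ) 2
  have hsum : Complex.exp x - ∑ m ∈ Finset.range 2, (x : ℂ) ^ m / (m.factorial : ℂ)
      = ((Real.exp x - 1 - x : ℝ) : ℂ) := by
    simp [Finset.sum_range_succ, sub_sub]
  rwa [hsum, Complex.norm_real, Complex.norm_real, Real.norm_eq_abs, Real.norm_eq_abs, sq_abs] at h

/-- If `r → ∞` and `r u → v`, then `r² (e^u - 1 - u) → v² / 2`. -/
theorem tendsto_sq_mul_exp_sub_one_sub_id {ι : Type*} {l : Filter ι} {r u : ι → ℝ} {v : ℝ}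
    (hr : Tendsto r l atTop) (hv : Tendsto (fun i => r i * u i) l (nhds v)) :
    Tendsto (fun i => r i ^ 2 * (Real.exp (u i) - 1 - u i)) l (nhds (v ^ 2 / 2)) := by
  have hu : Tendsto u l (nhds 0) := by
    refine (hv.div_atTop hr).congr' ?_
    filter_upwards [hr.eventually_gt_atTop 0] with i hi
    field_simp
  have hrem : Tendsto (fun i => r i ^ 2 * (Real.exp (u i) - 1 - u i - u i ^ 2 / 2)) l
      (nhds 0) := by
    have hbig : (fun i => r i ^ 2 * u i ^ 2) =O[l] fun _ => (1 : ℝ) := by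
      simpa only [mul_pow] using (hv.pow 2).isBigO_one ℝ
    have hsmall := (Real.exp_sub_sum_range_succ_isLittleO_pow 2).comp_tendsto hu
    have hprod := (Asymptotics.isBigO_refl (fun i => r i ^ 2) l).mul_isLittleO hsmall
    refine ((Asymptotics.isLittleO_one_iff ℝ).mp (hprod.trans_isBigO hbig)).congr fun i => ?_
    have hsum : ∑ k ∈ Finset.range (2 + 1), u i ^ k / (k.factorial : ℝ)
        = 1 + u i + u i ^ 2 / 2 := by
      simp [Finset.sum_range_succ]
    rw [Function.comp_apply, hsum]
    ring
  have hmain := hrem.add ((hv.pow 2).div_const 2)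
  rw [zero_add] at hmain
  exact hmain.congr fun i => by ring

/-- Second-order expansion of the Laplace transform of `T ∧ √n` at `θ / √n + a / n`. -/
theorem tendsto_mul_exp_mul_integral_exp_neg_mul_min_sub_one {Ω : Type*} [MeasurableSpace Ω]
    {μ : Measure Ω} [IsProbabilityMeasure μ] {T : Ω → ℝ} (hT_meas : Measurable T)
    (hT_pos : ∀ᵐ ω ∂μ, 0 < T ω) (hT_mean : ∫ ω, T ω ∂μ = 1) (hT : Integrable T μ)
    (hT2 : Integrable (fun ω => T ω ^ 2) μ) (θ a : ℝ) :
    Tendsto (fun n : ℕ => (n : ℝ) * (Real.exp (θ / √(n : ℝ)) *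
        ∫ ω, Real.exp (-(θ / √(n : ℝ) + a / n) * min (T ω) √(n : ℝ)) ∂μ - 1))
      atTop (nhds ((∫ ω, (T ω - 1) ^ 2 ∂μ) / 2 * θ ^ 2 - a)) := by
  have hsqrt : Tendsto (fun n : ℕ => √(n : ℝ)) atTop atTop :=
    Real.tendsto_sqrt_atTop.comp tendsto_natCast_atTop_atTop
  have hint (n : ℕ) (t : ℝ) : Integrable (fun ω => Real.exp (t * min (T ω) √(n : ℝ))) μ := by
    refine ProbabilityTheory.integrable_exp_mul_of_mem_Icc (a := 0) (b := √(n : ℝ))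
      (hT_meas.min measurable_const).aemeasurable ?_
    filter_upwards [hT_pos] with ω hω
    exact ⟨le_min hω.le (Real.sqrt_nonneg _), min_le_right _ _⟩
  have hint_sub : Integrable (fun ω => T ω - 1) μ := hT.sub (integrable_const 1)
  have hint_sub_sq : Integrable (fun ω => (T ω - 1) ^ 2) μ := by
    refine ((hT2.sub (hT.const_mul 2)).add (integrable_const 1)).congr (.of_forall fun ω => ?_)
    simp only [Pi.add_apply, Pi.sub_apply]
    ring
  let u (n : ℕ) (ω : Ω) : ℝ :=
    θ / √(n : ℝ) - (θ / √(n : ℝ) + a / n) * min (T ω) √(n : ℝ)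
  -- Adding the centred variable `θ √n (T - 1)` removes the divergent first-order term.
  let G (n : ℕ) (ω : Ω) : ℝ :=
    (n : ℝ) * (Real.exp (θ / √(n : ℝ)) *
      Real.exp (-(θ / √(n : ℝ) + a / n) * min (T ω) √(n : ℝ)) - 1) + θ * √(n : ℝ) * (T ω - 1)
  have hexp_int (n : ℕ) : Integrable (fun ω => (n : ℝ) * (Real.exp (θ / √(n : ℝ)) *
      Real.exp (-(θ / √(n : ℝ) + a / n) * min (T ω) √(n : ℝ)) - 1)) μ :=
    (((hint n _).const_mul _).sub (integrable_const 1)).const_mul _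
  have hG_int (n : ℕ) : Integrable (G n) μ := (hexp_int n).add (hint_sub.const_mul _)
  have hG_integral (n : ℕ) : ∫ ω, G n ω ∂μ = (n : ℝ) * (Real.exp (θ / √(n : ℝ)) *
      ∫ ω, Real.exp (-(θ / √(n : ℝ) + a / n) * min (T ω) √(n : ℝ)) ∂μ - 1) := by
    simp only [G]
    rw [integral_add (hexp_int n) (hint_sub.const_mul _), integral_const_mul, integral_const_mul,
      integral_sub ((hint n _).const_mul _) (integrable_const 1), integral_const_mul,
      integral_sub hT (integrable_const 1), hT_mean]
    simp
  have hG_eq {n : ℕ} (hn : 1 ≤ n) (ω : Ω) : G n ω = √(n : ℝ) ^ 2 * (Real.exp (u n ω) - 1 - u n ω)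
      + θ * (√(n : ℝ) * (T ω - min (T ω) √(n : ℝ))) - a * min (T ω) √(n : ℝ) := by
    have hr : 0 < √(n : ℝ) := Real.sqrt_pos.mpr (by exact_mod_cast hn)
    have hsq : (n : ℝ) = √(n : ℝ) ^ 2 := (Real.sq_sqrt n.cast_nonneg).symm
    simp only [G, u]
    rw [← Real.exp_add, neg_mul, ← sub_eq_add_neg]
    generalize √(n : ℝ) = r at hr hsq ⊢
    rw [hsq]
    field_simp
    ring
  have hru {n : ℕ} (hn : 1 ≤ n) (ω : Ω) : √(n : ℝ) * u n ω
      = θ - (θ + a / √(n : ℝ)) * min (T ω) √(n : ℝ) := by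
    have hr : 0 < √(n : ℝ) := Real.sqrt_pos.mpr (by exact_mod_cast hn)
    have hsq : (n : ℝ) = √(n : ℝ) ^ 2 := (Real.sq_sqrt n.cast_nonneg).symm
    simp only [u]
    generalize √(n : ℝ) = r at hr hsq ⊢
    rw [hsq]
    field_simp
  have hlim_integral : ∫ ω, (θ ^ 2 / 2 * (T ω - 1) ^ 2 - a * T ω) ∂μ
      = (∫ ω, (T ω - 1) ^ 2 ∂μ) / 2 * θ ^ 2 - a := by
    rw [integral_sub (hint_sub_sq.const_mul _) (hT.const_mul _), integral_const_mul,
      integral_const_mul, hT_mean]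
    ring
  simp only [← hG_integral]
  rw [← hlim_integral]
  let K : ℝ := 2 * |θ| + |a|
  refine tendsto_integral_filter_of_dominated_convergence
    (fun ω => Real.exp K * (K ^ 2 * (T ω ^ 2 + 2 * T ω + 1)) + |θ| * T ω ^ 2 + |a| * T ω)
    (.of_forall fun n => (hG_int n).aestronglyMeasurable) ?_ ?_ ?_
  · filter_upwards [eventually_ge_atTop 1] with n hn
    filter_upwards [hT_pos] with ω hω
    have hr : 1 ≤ √(n : ℝ) := Real.one_le_sqrt.mpr (by exact_mod_cast hn)
    have hru_le : |√(n : ℝ) * u n ω| ≤ |θ| + (|θ| + |a|) * min (T ω) √(n : ℝ) := by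
      have hX : 0 ≤ min (T ω) √(n : ℝ) := le_min hω.le (by linarith)
      have ha : |a / √(n : ℝ)| ≤ |a| := by
        rw [abs_div, abs_of_pos (by linarith : 0 < √(n : ℝ))]
        exact div_le_self (abs_nonneg a) hr
      rw [hru hn]
      refine (abs_sub _ _).trans ?_
      rw [abs_mul, abs_of_nonneg hX]
      gcongr
      exact (abs_add_le _ _).trans (by gcongr)
    have hX_le := min_le_left (T ω) √(n : ℝ)
    have hX_le' := min_le_right (T ω) √(n : ℝ)
    have hX_pos : 0 < min (T ω) √(n : ℝ) := lt_min hω (by linarith)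
    have hX_sub : √(n : ℝ) * (T ω - min (T ω) √(n : ℝ)) ≤ T ω ^ 2 := by
      rcases le_total (T ω) √(n : ℝ) with h | h
      · rw [min_eq_left h]; nlinarith
      · rw [min_eq_right h]; nlinarith
    rw [hG_eq hn, Real.norm_eq_abs]
    generalize min (T ω) √(n : ℝ) = X at *
    generalize √(n : ℝ) = r at *
    generalize u n ω = w at *
    have hθ := abs_nonneg θ
    have ha := abs_nonneg a
    have hw : |w| ≤ K := by
      rw [abs_mul, abs_of_pos (by linarith : 0 < r)] at hru_le
      refine le_of_mul_le_mul_left (hru_le.trans ?_) (by linarith : 0 < r)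
      simp only [K]
      nlinarith [mul_le_mul_of_nonneg_left hX_le' (add_nonneg hθ ha)]
    have hrw : |r * w| ≤ K * (T ω + 1) := by
      refine hru_le.trans ?_
      simp only [K]
      nlinarith [mul_le_mul_of_nonneg_left hX_le (add_nonneg hθ ha), mul_nonneg hθ hω.le]
    have hquad : |r ^ 2 * (Real.exp w - 1 - w)|
        ≤ Real.exp K * (K ^ 2 * (T ω ^ 2 + 2 * T ω + 1)) := by
      calc |r ^ 2 * (Real.exp w - 1 - w)| = r ^ 2 * |Real.exp w - 1 - w| := by
            rw [abs_mul, abs_of_nonneg (sq_nonneg r)]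
        _ ≤ r ^ 2 * (w ^ 2 * Real.exp |w|) := by
            gcongr; exact abs_exp_sub_one_sub_id_le_sq_mul_exp_abs w
        _ = Real.exp |w| * |r * w| ^ 2 := by rw [sq_abs]; ring
        _ ≤ Real.exp K * (K * (T ω + 1)) ^ 2 := by gcongr
        _ = _ := by ring
    have hlin : |θ * (r * (T ω - X))| ≤ |θ| * T ω ^ 2 := by
      rw [abs_mul, abs_of_nonneg (mul_nonneg (by linarith) (sub_nonneg.mpr hX_le))]
      gcongr
    have haX : |a * X| ≤ |a| * T ω := by
      rw [abs_mul, abs_of_pos hX_pos]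
      gcongr
    exact (abs_sub _ _).trans (add_le_add ((abs_add_le _ _).trans (add_le_add hquad hlin)) haX)
  · exact ((((hT2.add (hT.const_mul 2)).add (integrable_const 1)).const_mul _).const_mul _
      |>.add (hT2.const_mul _)).add (hT.const_mul _)
  · refine .of_forall fun ω => ?_
    have hmin : ∀ᶠ n : ℕ in atTop, min (T ω) √(n : ℝ) = T ω :=
      (hsqrt.eventually_ge_atTop (T ω)).mono fun n h => min_eq_left h
    have hru_lim : Tendsto (fun n : ℕ => √(n : ℝ) * u n ω) atTop
        (nhds (θ - (θ + 0) * T ω)) := by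
      refine (((hsqrt.const_div_atTop a).const_add θ).mul_const (T ω) |>.const_sub θ).congr' ?_
      filter_upwards [hmin, eventually_ge_atTop 1] with n h hn
      rw [hru hn, h]
    have hlim := (tendsto_sq_mul_exp_sub_one_sub_id hsqrt hru_lim).sub_const (a * T ω)
    rw [show θ ^ 2 / 2 * (T ω - 1) ^ 2 - a * T ω
      = (θ - (θ + 0) * T ω) ^ 2 / 2 - a * T ω by ring]
    refine hlim.congr' ?_
    filter_upwards [hmin, eventually_ge_atTop 1] with n h hn
    rw [hG_eq hn, h]
    ring

/-- Lemma 4.2 (`SDQ-eta-zeta1`), first part: existence, uniqueness and second-order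
asymptotics of the exponent `η⁽ⁿ⁾(θ)` defined by `e^θ E[e^{−η (T ∧ √n)}] = 1`. -/
theorem stmt4
    {Ω : Type*} [MeasurableSpace Ω] (μ : Measure Ω) [IsProbabilityMeasure μ]
    (T : Ω → ℝ) (hT_meas : Measurable T)
    (hT_pos : ∀ᵐ ω ∂μ, 0 < T ω)
    (hT_mean : ∫ ω, T ω ∂μ = 1)
    (hT3 : Integrable (fun ω => (T ω) ^ 3) μ)
    (σ2 : ℝ) (hσ2 : σ2 = ∫ ω, (T ω - 1) ^ 2 ∂μ) :
    (∀ n : ℕ, 1 ≤ n → ∀ θ : ℝ,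
      ∃! η : ℝ, Real.exp θ * ∫ ω, Real.exp (-η * min (T ω) (Real.sqrt (n : ℝ))) ∂μ = 1) ∧
    (∀ eta : ℕ → ℝ → ℝ,
      (∀ n : ℕ, 1 ≤ n → ∀ θ : ℝ,
        Real.exp θ * ∫ ω, Real.exp (-(eta n θ) * min (T ω) (Real.sqrt (n : ℝ))) ∂μ = 1) →
      ∀ θ : ℝ,
        Tendsto
          (fun n : ℕ => (n : ℝ) *
            (eta n (θ / Real.sqrt (n : ℝ)) - θ / Real.sqrt (n : ℝ)))
          atTop (nhds (σ2 / 2 * θ ^ 2))) := by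
  have hint_of_le {f : Ω → ℝ} (hf : Measurable f) (hle : ∀ ω, 0 < T ω → |f ω| ≤ 1 + T ω ^ 3) :
      Integrable f μ :=
    ((integrable_const 1).add hT3).mono' hf.aestronglyMeasurable (hT_pos.mono hle)
  have hT : Integrable T μ := hint_of_le hT_meas fun ω hω => by
    rw [abs_of_pos hω]
    nlinarith [mul_nonneg hω.le (sq_nonneg (T ω - 1)), sq_nonneg (T ω - 1)]
  have hT2 : Integrable (fun ω => T ω ^ 2) μ := hint_of_le (hT_meas.pow_const 2) fun ω hω => by
    rw [abs_of_pos (by positivity)]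
    nlinarith [mul_nonneg hω.le (sq_nonneg (T ω - 1)), sq_nonneg (T ω - 1)]
  have hmin_meas (n : ℕ) : AEMeasurable (fun ω => min (T ω) √(n : ℝ)) μ :=
    (hT_meas.min measurable_const).aemeasurable
  have hmin_pos {n : ℕ} (hn : 1 ≤ n) : ∀ᵐ ω ∂μ, 0 < min (T ω) √(n : ℝ) :=
    hT_pos.mono fun ω hω => lt_min hω (Real.sqrt_pos.mpr (by exact_mod_cast hn))
  have hmin_le (n : ℕ) : ∀ᵐ ω ∂μ, min (T ω) √(n : ℝ) ≤ √(n : ℝ) :=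
    .of_forall fun ω => min_le_right _ _
  have hanti {n : ℕ} (hn : 1 ≤ n) :=
    strictAnti_integral_exp_neg_mul (hmin_meas n) (hmin_pos hn) (hmin_le n)
  refine ⟨fun n hn θ => ?_, fun eta heta θ => ?_⟩
  · obtain ⟨η, hη⟩ := exists_integral_exp_neg_mul_eq (hmin_meas n) (hmin_pos hn) (hmin_le n)
      (Real.exp_pos (-θ))
    refine ⟨η, ?_, fun η' hη' => (hanti hn).injective ?_⟩
    · simp only [hη]
      rw [← Real.exp_add, add_neg_cancel, Real.exp_zero]
    · simp only [hη]
      rw [Real.exp_neg]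
      exact eq_inv_of_mul_eq_one_right hη'
  · have hexp := tendsto_mul_exp_mul_integral_exp_neg_mul_min_sub_one hT_meas hT_pos hT_mean
      hT hT2 θ
    rw [← hσ2] at hexp
    refine tendsto_order.mpr ⟨fun a ha => ?_, fun a ha => ?_⟩
    · filter_upwards [(hexp a).eventually_const_lt (sub_pos.mpr ha), eventually_ge_atTop 1]
        with n h hn
      have hn' : (0 : ℝ) < n := by exact_mod_cast hn
      have hgt := sub_pos.mp (pos_of_mul_pos_right h hn'.le)
      rw [← heta n hn (θ / √(n : ℝ))] at hgt
      have hlt := (hanti hn).lt_iff_gt.mp (lt_of_mul_lt_mul_left hgt (Real.exp_pos _).le)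
      rw [mul_comm, ← div_lt_iff₀ hn']
      linarith
    · filter_upwards [(hexp a).eventually_lt_const (sub_neg.mpr ha), eventually_ge_atTop 1]
        with n h hn
      have hn' : (0 : ℝ) < n := by exact_mod_cast hn
      have hgt := sub_neg.mp (neg_of_mul_neg_right h hn'.le)
      rw [← heta n hn (θ / √(n : ℝ))] at hgt
      have hlt := (hanti hn).lt_iff_gt.mp (lt_of_mul_lt_mul_left hgt (Real.exp_pos _).le)
      rw [mul_comm, ← lt_div_iff₀ hn']
      linarith
end

section
/- There exist constants d > 0 and a > 0 such that for all n ≥ 1 and all θ ∈ ℝ with n^{−1/2}|θ| < a, one has |η⁽ⁿ⁾(n^{−1/2}θ)| ≤ d·n^{−1/2}|θ|; consequently |η⁽ⁿ⁾(n^{−1/2}θ)·(u ∧ n^{1/2})| ≤ |θ|·d·((n^{−1/2}u) ∧ 1) for every u ≥ 0. -/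
open MeasureTheory Filter

/-- If `V ≤ 1` is almost surely positive and dominated by `S`, the root `η` of
`exp t * E[exp (-η S)] = 1` is bounded linearly in `t` for `t` small. -/
lemma abs_root_le_of_dominated
    {Ω : Type*} [MeasurableSpace Ω] {μ : Measure Ω} [IsProbabilityMeasure μ]
    {V S : Ω → ℝ} (hV : Integrable V μ) (hV_pos : ∀ᵐ ω ∂μ, 0 < V ω)
    (hV_one : ∀ ω, V ω ≤ 1) (hVS : ∀ ω, V ω ≤ S ω) {η t : ℝ}
    (h : Real.exp t * ∫ ω, Real.exp (-η * S ω) ∂μ = 1)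
    (ht : |t| < (∫ ω, V ω ∂μ) / 2) :
    |η| ≤ 2 / (∫ ω, V ω ∂μ) * |t| := by
  set c := ∫ ω, V ω ∂μ with hc
  have hc_pos : 0 < c := by linarith [abs_nonneg t]
  have hc_one : c ≤ 1 := by
    calc c ≤ ∫ _, (1 : ℝ) ∂μ := integral_mono hV (integrable_const _) hV_one
      _ = 1 := by simp
  have hI : ∫ ω, Real.exp (-η * S ω) ∂μ = Real.exp (-t) := by
    rw [Real.exp_neg]
    exact eq_inv_of_mul_eq_one_right h
  have hint : Integrable (fun ω => Real.exp (-η * S ω)) μ := by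
    by_contra hn
    rw [integral_undef hn] at h
    simp at h
  suffices hmain : |η| * c ≤ 2 * |t| by
    rw [div_mul_eq_mul_div, le_div_iff₀ hc_pos]
    exact hmain
  rcases le_total η 0 with hη | hη
  · have hle : ∫ ω, (1 + |η| * V ω) ∂μ ≤ ∫ ω, Real.exp (-η * S ω) ∂μ := by
      refine integral_mono ((integrable_const _).add (hV.const_mul _)) hint fun ω => ?_
      have h1 := Real.add_one_le_exp (-η * S ω)
      have h2 := mul_le_mul_of_nonneg_left (hVS ω) (neg_nonneg.2 hη)
      simp only [abs_of_nonpos hη]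
      linarith
    rw [integral_add (integrable_const _) (hV.const_mul _), integral_const_mul, hI] at hle
    simp only [integral_const, probReal_univ, one_smul] at hle
    have h3 := Real.abs_exp_sub_one_le (x := -t) (by rw [abs_neg]; linarith)
    rw [abs_neg] at h3
    linarith [le_abs_self (Real.exp (-t) - 1)]
  · set m := min η 1 with hm
    have hm0 : 0 ≤ m := le_min hη zero_le_one
    have hm1 : m ≤ 1 := min_le_right _ _
    have hle : ∫ ω, Real.exp (-η * S ω) ∂μ ≤ ∫ ω, (1 - m / 2 * V ω) ∂μ := by
      refine integral_mono_ae hint ((integrable_const _).sub (hV.const_mul _)) ?_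
      filter_upwards [hV_pos] with ω hω
      have hx0 : 0 ≤ m * V ω := mul_nonneg hm0 hω.le
      have hx1 : m * V ω ≤ 1 := mul_le_one₀ hm1 hω.le (hV_one ω)
      have hmono : m * V ω ≤ η * S ω :=
        mul_le_mul (min_le_left _ _) (hVS ω) hω.le hη
      have hexp : Real.exp (-η * S ω) ≤ (1 + m * V ω)⁻¹ := by
        rw [neg_mul, Real.exp_neg]
        exact inv_anti₀ (by linarith) (by linarith [Real.add_one_le_exp (η * S ω)])
      refine hexp.trans ?_
      rw [inv_le_iff_one_le_mul₀ (by linarith)]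
      nlinarith
    rw [integral_sub (integrable_const _) (hV.const_mul _), integral_const_mul, hI] at hle
    simp only [integral_const, probReal_univ, one_smul] at hle
    have hmt : m * c ≤ 2 * |t| := by
      linarith [Real.add_one_le_exp (-t), le_abs_self t]
    have hm_lt : m < 1 := by
      by_contra hcon
      have : m = 1 := le_antisymm hm1 (not_lt.1 hcon)
      rw [this] at hmt
      linarith
    have hmη : m = η := by
      rcases min_choice η 1 with h' | h'
      · exact h'
      · exact absurd (hm.trans h') hm_lt.ne
    rwa [abs_of_nonneg hη, ← hmη]

/-- Lemma 4.2 (`SDQ-eta-zeta1`), second part (4.5): a uniform linear bound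
`|η⁽ⁿ⁾(n^{−1/2}θ)| ≤ d n^{−1/2}|θ|` for `n^{−1/2}|θ| < a`, and its consequence
`|η⁽ⁿ⁾(n^{−1/2}θ) (u ∧ √n)| ≤ |θ| d ((n^{−1/2}u) ∧ 1)`. -/
theorem stmt5
    {Ω : Type*} [MeasurableSpace Ω] (μ : Measure Ω) [IsProbabilityMeasure μ]
    (T : Ω → ℝ) (hT_meas : Measurable T)
    (hT_pos : ∀ᵐ ω ∂μ, 0 < T ω)
    (hT_mean : ∫ ω, T ω ∂μ = 1)
    (hT3 : Integrable (fun ω => (T ω) ^ 3) μ)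
    (σ2 : ℝ) (hσ2 : σ2 = ∫ ω, (T ω - 1) ^ 2 ∂μ)
    (eta : ℕ → ℝ → ℝ)
    (heta : ∀ n : ℕ, 1 ≤ n → ∀ θ : ℝ,
      Real.exp θ * ∫ ω, Real.exp (-(eta n θ) * min (T ω) (Real.sqrt (n : ℝ))) ∂μ = 1) :
    ∃ d > (0:ℝ), ∃ a > (0:ℝ), ∀ n : ℕ, 1 ≤ n → ∀ θ : ℝ,
      |θ| / Real.sqrt (n : ℝ) < a →
        |eta n (θ / Real.sqrt (n : ℝ))| ≤ d * |θ| / Real.sqrt (n : ℝ) ∧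
        ∀ u : ℝ, 0 ≤ u →
          |eta n (θ / Real.sqrt (n : ℝ)) * min u (Real.sqrt (n : ℝ))|
            ≤ |θ| * d * min (u / Real.sqrt (n : ℝ)) 1 := by
  have hV : Integrable (fun ω => min (T ω) 1) μ := by
    refine (integrable_const (1 : ℝ)).mono' (hT_meas.min measurable_const).aestronglyMeasurable ?_
    filter_upwards [hT_pos] with ω hω
    rw [Real.norm_of_nonneg (le_min hω.le zero_le_one)]
    exact min_le_right _ _
  have hV_pos : ∀ᵐ ω ∂μ, 0 < min (T ω) 1 := by
    filter_upwards [hT_pos] with ω hω using lt_min hω one_pos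
  have hc : 0 < ∫ ω, min (T ω) 1 ∂μ := by
    refine (integral_pos_iff_support_of_nonneg_ae (hV_pos.mono fun ω h => h.le) hV).2 ?_
    have hsupp : Function.support (fun ω => min (T ω) 1) =ᵐ[μ] Set.univ :=
      eventuallyEq_univ.2 (hV_pos.mono fun ω h => h.ne')
    rw [measure_congr hsupp, measure_univ]
    exact one_pos
  refine ⟨2 / ∫ ω, min (T ω) 1 ∂μ, by positivity, (∫ ω, min (T ω) 1 ∂μ) / 2, by positivity, ?_⟩
  intro n hn θ hθ
  have hs : 1 ≤ Real.sqrt (n : ℝ) := Real.one_le_sqrt.2 (by exact_mod_cast hn)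
  have hs_pos : 0 < Real.sqrt (n : ℝ) := one_pos.trans_le hs
  have habs : |θ / Real.sqrt (n : ℝ)| = |θ| / Real.sqrt (n : ℝ) := by
    rw [abs_div, abs_of_pos hs_pos]
  have hbound := abs_root_le_of_dominated hV hV_pos (fun ω => min_le_right _ _)
    (fun ω => min_le_min_left (T ω) hs) (heta n hn (θ / Real.sqrt (n : ℝ))) (habs ▸ hθ)
  rw [habs, ← mul_div_assoc] at hbound
  refine ⟨hbound, fun u hu => ?_⟩
  have hmin : min (u / Real.sqrt (n : ℝ)) 1 = min u (Real.sqrt (n : ℝ)) / Real.sqrt (n : ℝ) := by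
    rw [← min_div_div_right hs_pos.le, div_self hs_pos.ne']
  have hmin_nonneg : 0 ≤ min u (Real.sqrt (n : ℝ)) := le_min hu hs_pos.le
  rw [abs_mul, abs_of_nonneg hmin_nonneg, hmin]
  refine (mul_le_mul_of_nonneg_right hbound hmin_nonneg).trans_eq ?_
  ring
end

section
/- Let T and R be nonnegative random variables, c ≥ 0 a constant, and j ∈ {1,2} with E[T^{j+1}] < ∞. If P[R > y] ≤ c·E[(T − y)·1{T > y}] for every y ≥ 0, then (j+1)·E[R^{j}] ≤ c·E[T^{j+1}]. -/
open MeasureTheory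

theorem lintegral_Ioi_ofReal_sub_mul_pow (k : ℕ) {x : ℝ} (hx : 0 ≤ x) :
    ∫⁻ y in Set.Ioi (0 : ℝ), ENNReal.ofReal (x - y) * ENNReal.ofReal ((k + 1) * y ^ k) =
      ENNReal.ofReal (x ^ (k + 2) / (k + 2)) := by
  have hsplit : ∫⁻ y in Set.Ioi (0 : ℝ),
      ENNReal.ofReal (x - y) * ENNReal.ofReal ((k + 1) * y ^ k) =
      ∫⁻ y in Set.Ioc 0 x, ENNReal.ofReal ((x - y) * ((k + 1) * y ^ k)) := by
    rw [← lintegral_indicator measurableSet_Ioi, ← lintegral_indicator measurableSet_Ioc]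
    congr 1 with y
    by_cases h0 : 0 < y
    · by_cases hy : y ≤ x
      · simp [h0, hy, ENNReal.ofReal_mul (sub_nonneg.2 hy)]
      · simp [h0, hy, ENNReal.ofReal_of_nonpos (sub_nonpos.2 (not_le.1 hy).le)]
    · simp [h0]
  have hcont : Continuous fun y : ℝ => (x - y) * ((k + 1) * y ^ k) := by fun_prop
  rw [hsplit, ← ofReal_integral_eq_lintegral_ofReal]
  · rw [← intervalIntegral.integral_of_le hx]
    congr 1
    have hderiv : ∀ y ∈ Set.uIcc 0 x, HasDerivAt
        (fun y : ℝ => x * y ^ (k + 1) - (k + 1) * y ^ (k + 2) / (k + 2))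
        ((x - y) * ((k + 1) * y ^ k)) y := by
      intro y _
      have h := ((hasDerivAt_pow (k + 1) y).const_mul x).sub
        (((hasDerivAt_pow (k + 2) y).const_mul ((k : ℝ) + 1)).div_const ((k : ℝ) + 2))
      refine h.congr_deriv ?_
      have : (k : ℝ) + 2 ≠ 0 := by positivity
      simp only [Nat.add_sub_cancel, show k + 2 - 1 = k + 1 from rfl]
      push_cast
      field_simp
      ring
    rw [intervalIntegral.integral_eq_sub_of_hasDerivAt hderiv (hcont.intervalIntegrable _ _)]
    have : (k : ℝ) + 2 ≠ 0 := by positivity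
    simp
    field_simp
    ring
  · exact (hcont.integrableOn_Icc (a := 0) (b := x)).mono_set Set.Ioc_subset_Icc_self
  · filter_upwards [ae_restrict_mem measurableSet_Ioc] with y hy
    have := hy.1
    exact mul_nonneg (sub_nonneg.2 hy.2) (by positivity)

theorem ofReal_setIntegral_sub_le_lintegral {Ω : Type*} [MeasurableSpace Ω] (μ : Measure Ω)
    {T : Ω → ℝ} (hT : Measurable T) (y : ℝ) :
    ENNReal.ofReal (∫ ω in {ω | y < T ω}, (T ω - y) ∂μ) ≤ ∫⁻ ω, ENNReal.ofReal (T ω - y) ∂μ := by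
  have hS : MeasurableSet {ω | y < T ω} := measurableSet_lt measurable_const hT
  rw [integral_eq_lintegral_of_nonneg_ae]
  · exact ENNReal.ofReal_toReal_le.trans (setLIntegral_le_lintegral _ _)
  · filter_upwards [ae_restrict_mem hS] with ω hω
    exact sub_nonneg.2 (le_of_lt hω)
  · exact (hT.sub_const y).aestronglyMeasurable

theorem lintegral_pow_succ_eq_lintegral_meas_lt_mul {Ω : Type*} [MeasurableSpace Ω]
    (μ : Measure Ω) {R : Ω → ℝ} (hR : Measurable R) (hR0 : ∀ ω, 0 ≤ R ω) (k : ℕ) :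
    ∫⁻ ω, ENNReal.ofReal (R ω ^ (k + 1)) ∂μ =
      ∫⁻ y in Set.Ioi (0 : ℝ), μ {ω | y < R ω} * ENNReal.ofReal ((k + 1) * y ^ k) := by
  rw [← lintegral_comp_eq_lintegral_meas_lt_mul μ (.of_forall hR0) hR.aemeasurable]
  · congr 1 with ω
    have : (k : ℝ) + 1 ≠ 0 := by positivity
    rw [intervalIntegral.integral_const_mul, integral_pow]
    simp
    field_simp
  · intro t _
    exact Continuous.intervalIntegrable (by fun_prop) _ _
  · filter_upwards [ae_restrict_mem measurableSet_Ioi] with y hy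
    have : 0 < y := hy
    positivity

theorem lintegral_pow_succ_le_of_tail_le {Ω₁ Ω₂ : Type*} [MeasurableSpace Ω₁] [MeasurableSpace Ω₂]
    (μ₁ : Measure Ω₁) (μ₂ : Measure Ω₂) [SFinite μ₁] [IsFiniteMeasure μ₂]
    {T : Ω₁ → ℝ} {R : Ω₂ → ℝ} (hT : Measurable T) (hR : Measurable R)
    (hT0 : ∀ ω, 0 ≤ T ω) (hR0 : ∀ ω, 0 ≤ R ω) {c : ℝ} (hc : 0 ≤ c) (k : ℕ)
    (htail : ∀ y : ℝ, 0 ≤ y →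
      (μ₂ {ω | y < R ω}).toReal ≤ c * ∫ ω in {ω | y < T ω}, (T ω - y) ∂μ₁) :
    ∫⁻ ω, ENNReal.ofReal (R ω ^ (k + 1)) ∂μ₂ ≤
      ENNReal.ofReal c * ∫⁻ ω, ENNReal.ofReal (T ω ^ (k + 2) / (k + 2)) ∂μ₁ := by
  have htail' : ∀ y : ℝ, 0 ≤ y →
      μ₂ {ω | y < R ω} ≤ ENNReal.ofReal c * ∫⁻ ω, ENNReal.ofReal (T ω - y) ∂μ₁ := by
    intro y hy
    rw [← ENNReal.ofReal_toReal (measure_ne_top μ₂ {ω | y < R ω})]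
    refine (ENNReal.ofReal_le_ofReal (htail y hy)).trans ?_
    rw [ENNReal.ofReal_mul hc]
    gcongr
    exact ofReal_setIntegral_sub_le_lintegral μ₁ hT y
  calc ∫⁻ ω, ENNReal.ofReal (R ω ^ (k + 1)) ∂μ₂
      = ∫⁻ y in Set.Ioi (0 : ℝ), μ₂ {ω | y < R ω} * ENNReal.ofReal ((k + 1) * y ^ k) :=
        lintegral_pow_succ_eq_lintegral_meas_lt_mul μ₂ hR hR0 k
    _ ≤ ∫⁻ y in Set.Ioi (0 : ℝ), ENNReal.ofReal c *
          ∫⁻ ω, ENNReal.ofReal (T ω - y) * ENNReal.ofReal ((k + 1) * y ^ k) ∂μ₁ := by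
        refine setLIntegral_mono' measurableSet_Ioi fun y hy => ?_
        rw [lintegral_mul_const _ (by fun_prop), ← mul_assoc]
        gcongr
        exact htail' y (le_of_lt hy)
    _ = ENNReal.ofReal c * ∫⁻ ω, (∫⁻ y in Set.Ioi (0 : ℝ),
          ENNReal.ofReal (T ω - y) * ENNReal.ofReal ((k + 1) * y ^ k)) ∂μ₁ := by
        rw [lintegral_const_mul' _ _ ENNReal.ofReal_ne_top, lintegral_lintegral_swap]
        exact Measurable.aemeasurable (by unfold Function.uncurry; fun_prop)
    _ = _ := by simp only [lintegral_Ioi_ofReal_sub_mul_pow k (hT0 _)]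

/-- Lemma 4.4 (`SDQ-moment`), inequalities (4.7)–(4.8): a tail bound
`P[R > y] ≤ c E[(T − y) 1{T > y}]` implies the moment bound
`(j+1) E[R^j] ≤ c E[T^{j+1}]` for `j = 1, 2`. -/
theorem stmt7
    {Ω₁ Ω₂ : Type*} [MeasurableSpace Ω₁] [MeasurableSpace Ω₂]
    (μ₁ : Measure Ω₁) (μ₂ : Measure Ω₂)
    [IsProbabilityMeasure μ₁] [IsProbabilityMeasure μ₂]
    (T : Ω₁ → ℝ) (R : Ω₂ → ℝ)
    (hT_meas : Measurable T) (hR_meas : Measurable R)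
    (hT_nonneg : ∀ ω, 0 ≤ T ω) (hR_nonneg : ∀ ω, 0 ≤ R ω)
    (c : ℝ) (hc : 0 ≤ c)
    (j : ℕ) (hj : j = 1 ∨ j = 2)
    (hTj : Integrable (fun ω => (T ω) ^ (j + 1)) μ₁)
    (htail : ∀ y : ℝ, 0 ≤ y →
      (μ₂ {ω | y < R ω}).toReal ≤ c * ∫ ω in {ω | y < T ω}, (T ω - y) ∂μ₁) :
    ((j : ℝ) + 1) * ∫ ω, (R ω) ^ j ∂μ₂ ≤ c * ∫ ω, (T ω) ^ (j + 1) ∂μ₁ := by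
  obtain ⟨k, rfl⟩ : ∃ k, j = k + 1 := ⟨j - 1, by omega⟩
  have hle := lintegral_pow_succ_le_of_tail_le μ₁ μ₂ hT_meas hR_meas hT_nonneg hR_nonneg hc k htail
  have hT0 : ∀ ω, 0 ≤ T ω ^ (k + 2) / ((k : ℝ) + 2) := fun ω => by
    have := hT_nonneg ω
    positivity
  rw [← ofReal_integral_eq_lintegral_ofReal (hTj.div_const _) (.of_forall hT0),
    ← ENNReal.ofReal_mul hc, integral_div] at hle
  have hTint : 0 ≤ ∫ ω, T ω ^ (k + 2) ∂μ₁ :=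
    integral_nonneg fun ω => pow_nonneg (hT_nonneg ω) _
  have hreal : ∫ ω, R ω ^ (k + 1) ∂μ₂ ≤ c * ((∫ ω, T ω ^ (k + 2) ∂μ₁) / ((k : ℝ) + 2)) := by
    rw [integral_eq_lintegral_of_nonneg_ae (.of_forall fun ω => pow_nonneg (hR_nonneg ω) _)
      (hR_meas.pow_const _).aestronglyMeasurable]
    exact ENNReal.toReal_le_of_le_ofReal (by positivity) hle
  have hk : (0 : ℝ) < (k : ℝ) + 2 := by positivity
  rw [← mul_div_assoc, le_div_iff₀ hk] at hreal
  push_cast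
  linarith
end

section
/- Let T be a nonnegative random variable with E[T³] < ∞, c ≥ 0 a constant, and (R_n)_{n≥1} a family of nonnegative random variables such that P[R_n > y] ≤ c·E[(T − y)·1{T > y}] for all n ≥ 1 and all y ≥ 0. Then for each j ∈ {0,1,2}, n^{(2−j)/2}·E[R_n^{j}·1{R_n > n^{1/2}}] → 0 as n → ∞, i.e. E[R_n^{j}·1{R_n > n^{1/2}}] = o(n^{−(2−j)/2}). -/
open MeasureTheory Filter

/-- If the tails of `f` under `μ` are at most `C` times those of `g` under `ν`, then the second
moment of `f` is at most `C` times that of `g`. -/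
theorem lintegral_sq_le_of_meas_lt_le {α β : Type*} [MeasurableSpace α] [MeasurableSpace β]
    {μ : Measure α} {ν : Measure β} {f : α → ℝ} {g : β → ℝ}
    (hf : Measurable f) (hg : Measurable g) (hf0 : ∀ x, 0 ≤ f x) (hg0 : ∀ x, 0 ≤ g x)
    {C : ENNReal} (hC : C ≠ ⊤)
    (h : ∀ t : ℝ, 0 < t → μ {x | t < f x} ≤ C * ν {x | t < g x}) :
    ∫⁻ x, ENNReal.ofReal (f x ^ 2) ∂μ ≤ C * ∫⁻ x, ENNReal.ofReal (g x ^ 2) ∂ν := by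
  have hμ := lintegral_rpow_eq_lintegral_meas_lt_mul μ (Eventually.of_forall hf0)
    hf.aemeasurable (p := 2) two_pos
  have hν := lintegral_rpow_eq_lintegral_meas_lt_mul ν (Eventually.of_forall hg0)
    hg.aemeasurable (p := 2) two_pos
  simp only [Real.rpow_two] at hμ hν
  rw [hμ, hν, mul_left_comm, ← lintegral_const_mul' _ _ hC]
  gcongr ENNReal.ofReal 2 * ?_
  refine setLIntegral_mono' measurableSet_Ioi fun t ht => ?_
  rw [← mul_assoc]
  gcongr
  exact h t ht

/-- If the tails of `R` are bounded by `c * E[(T - y)⁺]`, then the truncated second moment of `R`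
is bounded by `c` times the truncated third moment of `T`. -/
theorem setLIntegral_sq_le_of_tail_le {α β : Type*} [MeasurableSpace α] [MeasurableSpace β]
    {μ : Measure α} {ν : Measure β} [IsFiniteMeasure μ] {R : α → ℝ} {T : β → ℝ}
    (hR : Measurable R) (hT : Measurable T) (hR0 : ∀ x, 0 ≤ R x) (hT0 : ∀ x, 0 ≤ T x)
    (hT3 : Integrable (fun x => T x ^ 3) ν) {c : ℝ} (hc : 0 ≤ c)
    (htail : ∀ y : ℝ, 0 ≤ y →
      (μ {x | y < R x}).toReal ≤ c * ∫ x in {x | y < T x}, (T x - y) ∂ν)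
    (s : ℝ) :
    ∫⁻ x in {x | s < R x}, ENNReal.ofReal (R x ^ 2) ∂μ ≤
      ENNReal.ofReal (c * ∫ x in {x | s < T x}, T x ^ 3 ∂ν) := by
  have hTm : Measurable fun x => ENNReal.ofReal (T x) := hT.ennreal_ofReal
  have hmeas : ∀ y, MeasurableSet {x | y < T x} := fun y => measurableSet_lt measurable_const hT
  have key := lintegral_sq_le_of_meas_lt_le (μ := μ.restrict {x | s < R x})
    (ν := (ν.restrict {x | s < T x}).withDensity fun x => ENNReal.ofReal (T x))
    hR hT hR0 hT0 (C := ENNReal.ofReal c) ENNReal.ofReal_ne_top ?_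
  · refine key.trans_eq ?_
    rw [ENNReal.ofReal_mul hc, ofReal_integral_eq_lintegral_ofReal hT3.integrableOn
      (Eventually.of_forall fun x => pow_nonneg (hT0 x) 3),
      lintegral_withDensity_eq_lintegral_mul _ hTm (hT.pow_const 2).ennreal_ofReal]
    congr 1
    refine lintegral_congr fun x => ?_
    rw [Pi.mul_apply, ← ENNReal.ofReal_mul (hT0 x)]
    ring_nf
  · intro t ht
    have hy : 0 ≤ max t s := ht.le.trans (le_max_left t s)
    rw [Measure.restrict_apply (measurableSet_lt measurable_const hR),
      withDensity_apply _ (hmeas t), Measure.restrict_restrict (hmeas t)]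
    simp only [← Set.ofPred_and, ← max_lt_iff]
    calc μ {x | max t s < R x} = ENNReal.ofReal (μ {x | max t s < R x}).toReal :=
          (ENNReal.ofReal_toReal (measure_ne_top _ _)).symm
      _ ≤ ENNReal.ofReal (c * ∫ x in {x | max t s < T x}, (T x - max t s) ∂ν) :=
          ENNReal.ofReal_le_ofReal (htail _ hy)
      _ ≤ ENNReal.ofReal c *
          ∫⁻ x in {x | max t s < T x}, ENNReal.ofReal (T x - max t s) ∂ν := by
          rw [ENNReal.ofReal_mul hc, integral_eq_lintegral_of_nonneg_ae
            ((ae_restrict_mem (hmeas _)).mono fun x hx => sub_nonneg.2 (le_of_lt hx))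
            (hT.sub_const _).aestronglyMeasurable]
          gcongr
          exact ENNReal.ofReal_toReal_le
      _ ≤ _ := by
          gcongr with x
          linarith

/-- The tail part of the integral of an integrable function vanishes. -/
theorem tendsto_setIntegral_sqrt_lt {α : Type*} [MeasurableSpace α] {μ : Measure α}
    {T f : α → ℝ} (hT : Measurable T) (hf : Integrable f μ) :
    Tendsto (fun n : ℕ => ∫ x in {x | Real.sqrt (n : ℝ) < T x}, f x ∂μ) atTop (nhds 0) := by
  have hmeas : ∀ y, MeasurableSet {x | y < T x} := fun y => measurableSet_lt measurable_const hT
  simp_rw [← integral_indicator (hmeas _)]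
  rw [← integral_zero α ℝ (μ := μ)]
  refine tendsto_integral_of_dominated_convergence (fun x => ‖f x‖)
    (fun n => hf.aestronglyMeasurable.indicator (hmeas _)) hf.norm
    (fun n => Eventually.of_forall fun x => norm_indicator_le_norm_self _ _)
    (Eventually.of_forall fun x => tendsto_const_nhds.congr' ?_)
  have hsqrt : Tendsto (fun n : ℕ => Real.sqrt (n : ℝ)) atTop atTop :=
    Real.tendsto_sqrt_atTop.comp tendsto_natCast_atTop_atTop
  filter_upwards [hsqrt.eventually_ge_atTop (T x)] with n hn
  exact (Set.indicator_of_notMem (s := {x | Real.sqrt (n : ℝ) < T x}) (not_lt.2 hn) f).symm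

theorem natCast_rpow_mul_pow_le_sq {n j : ℕ} (hj : j ≤ 2) {r : ℝ}
    (hr : Real.sqrt (n : ℝ) < r) :
    (n : ℝ) ^ (((2 : ℝ) - (j : ℝ)) / 2) * r ^ j ≤ r ^ 2 := by
  have hpow : (n : ℝ) ^ (((2 : ℝ) - (j : ℝ)) / 2) = Real.sqrt (n : ℝ) ^ (2 - j) := by
    rw [Real.sqrt_eq_rpow, ← Real.rpow_mul_natCast n.cast_nonneg, Nat.cast_sub hj]
    congr 1
    push_cast
    ring
  have hr0 : 0 ≤ r := (Real.sqrt_nonneg _).trans hr.le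
  calc (n : ℝ) ^ (((2 : ℝ) - (j : ℝ)) / 2) * r ^ j = Real.sqrt (n : ℝ) ^ (2 - j) * r ^ j := by
        rw [hpow]
    _ ≤ r ^ (2 - j) * r ^ j := by gcongr
    _ = r ^ 2 := by rw [← pow_add, Nat.sub_add_cancel hj]

/-- Lemma 4.5 (`SDQ-t-moment`), inequality (4.10): under a uniform tail bound by a
random variable `T` with finite third moment, `E[R_n^j 1{R_n > √n}] = o(n^{−(2−j)/2})`
for `j = 0, 1, 2`. -/
theorem stmt8
    {Ω₁ : Type*} [MeasurableSpace Ω₁] (μ₁ : Measure Ω₁) [IsProbabilityMeasure μ₁]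
    {Ω₂ : ℕ → Type*} [∀ n, MeasurableSpace (Ω₂ n)]
    (μ₂ : ∀ n, Measure (Ω₂ n)) [∀ n, IsProbabilityMeasure (μ₂ n)]
    (T : Ω₁ → ℝ) (R : ∀ n, Ω₂ n → ℝ)
    (hT_meas : Measurable T) (hR_meas : ∀ n, Measurable (R n))
    (hT_nonneg : ∀ ω, 0 ≤ T ω) (hR_nonneg : ∀ n ω, 0 ≤ R n ω)
    (hT3 : Integrable (fun ω => (T ω) ^ 3) μ₁)
    (c : ℝ) (hc : 0 ≤ c)
    (htail : ∀ n : ℕ, 1 ≤ n → ∀ y : ℝ, 0 ≤ y →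
      ((μ₂ n) {ω | y < R n ω}).toReal ≤ c * ∫ ω in {ω | y < T ω}, (T ω - y) ∂μ₁) :
    ∀ j : ℕ, j ≤ 2 →
      Tendsto
        (fun n : ℕ => (n : ℝ) ^ (((2 : ℝ) - (j : ℝ)) / 2) *
          ∫ ω in {ω | Real.sqrt (n : ℝ) < R n ω}, (R n ω) ^ j ∂(μ₂ n))
        atTop (nhds 0) := by
  intro j hj
  have hlim := (tendsto_setIntegral_sqrt_lt hT_meas hT3).const_mul c
  rw [mul_zero] at hlim
  refine tendsto_of_tendsto_of_tendsto_of_le_of_le' tendsto_const_nhds hlim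
    (Eventually.of_forall fun n => mul_nonneg (by positivity)
      (integral_nonneg fun ω => pow_nonneg (hR_nonneg n ω) j)) ?_
  filter_upwards [eventually_ge_atTop 1] with n hn
  have hbound := setLIntegral_sq_le_of_tail_le (hR_meas n) hT_meas (hR_nonneg n) hT_nonneg hT3 hc
    (htail n hn) (Real.sqrt (n : ℝ))
  rw [← integral_const_mul, integral_eq_lintegral_of_nonneg_ae
    (Eventually.of_forall fun ω => mul_nonneg (by positivity) (pow_nonneg (hR_nonneg n ω) j))
    (((hR_meas n).pow_const j).const_mul _).aestronglyMeasurable]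
  refine ENNReal.toReal_le_of_le_ofReal
    (mul_nonneg hc (integral_nonneg fun ω => pow_nonneg (hT_nonneg ω) 3)) (le_trans ?_ hbound)
  exact setLIntegral_mono' (measurableSet_lt measurable_const (hR_meas n)) fun ω hω =>
    ENNReal.ofReal_le_ofReal (natCast_rpow_mul_pow_le_sq hj hω)
end

section
/- For each fixed θ ∈ ℝ there exist a constant C > 0 and an integer n₀ ≥ 1 such that for all n ≥ n₀ and all r ∈ [0, n^{1/2}]: | e^{−η⁽ⁿ⁾(n^{−1/2}θ)·r} − ( 1 − n^{−1/2}θ·r − (1/2)·n^{−1}θ²·(σ²·r − r²) ) | ≤ C·(r + r² + r³)·n^{−3/2}. -/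
open MeasureTheory Filter

lemma Real.abs_exp_sub_quadratic_le (x : ℝ) :
    |Real.exp x - (1 + x + x ^ 2 / 2)| ≤ |x| ^ 3 * Real.exp |x| := by
  have h := Complex.norm_exp_sub_sum_le_norm_mul_exp (x : ℂ) 3
  have h2 : Complex.exp (x : ℂ) - ∑ m ∈ Finset.range 3, (x : ℂ) ^ m / (m.factorial : ℂ)
      = ((Real.exp x - (1 + x + x ^ 2 / 2) : ℝ) : ℂ) := by
    simp [Finset.sum_range_succ, Nat.factorial]
  rw [h2, Complex.norm_real, Complex.norm_real] at h
  simpa using h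

lemma Real.exp_neg_le_quadratic {x : ℝ} (hx : 0 ≤ x) :
    Real.exp (-x) ≤ 1 - x + x ^ 2 / 2 := by
  have h := Real.quadratic_le_exp_of_nonneg hx
  have h3 : Real.exp (-x) * Real.exp x = 1 := by rw [← Real.exp_add]; simp
  have h4 : 0 < 1 - x + x ^ 2 / 2 := by nlinarith [sq_nonneg (x - 1)]
  have h5 : 1 ≤ (1 - x + x ^ 2 / 2) * Real.exp x := by
    nlinarith [mul_le_mul_of_nonneg_left h h4.le, sq_nonneg (x ^ 2)]
  exact le_of_mul_le_mul_right (h3 ▸ h5) (Real.exp_pos x)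

section BoundedVariable

variable {Ω : Type*} [MeasurableSpace Ω] {μ : Measure Ω} [IsProbabilityMeasure μ] {X : Ω → ℝ}
  {u : ℝ}

lemma integrable_pow_of_ae_mem_Icc (hX : Measurable X) (hX0 : ∀ᵐ ω ∂μ, 0 ≤ X ω)
    (hXu : ∀ ω, X ω ≤ u) (k : ℕ) : Integrable (fun ω => X ω ^ k) μ := by
  refine Integrable.of_bound (hX.pow_const k).aestronglyMeasurable (u ^ k) ?_
  filter_upwards [hX0] with ω h0
  rw [Real.norm_of_nonneg (by positivity)]
  exact pow_le_pow_left₀ h0 (hXu ω) k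

lemma integrable_exp_mul_of_ae_mem_Icc (hX : Measurable X) (hX0 : ∀ᵐ ω ∂μ, 0 ≤ X ω)
    (hXu : ∀ ω, X ω ≤ u) (c : ℝ) : Integrable (fun ω => Real.exp (c * X ω)) μ := by
  refine Integrable.of_bound (hX.const_mul c).exp.aestronglyMeasurable (Real.exp (|c| * u)) ?_
  filter_upwards [hX0] with ω h0
  rw [Real.norm_of_nonneg (Real.exp_pos _).le, Real.exp_le_exp]
  exact (mul_le_mul_of_nonneg_right (le_abs_self c) h0).trans
    (mul_le_mul_of_nonneg_left (hXu ω) (abs_nonneg c))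

lemma integral_quadratic_of_ae_mem_Icc (hX : Measurable X) (hX0 : ∀ᵐ ω ∂μ, 0 ≤ X ω)
    (hXu : ∀ ω, X ω ≤ u) (a b : ℝ) :
    Integrable (fun ω => 1 + a * X ω + b * X ω ^ 2) μ ∧
    ∫ ω, (1 + a * X ω + b * X ω ^ 2) ∂μ
      = 1 + a * ∫ ω, X ω ∂μ + b * ∫ ω, X ω ^ 2 ∂μ := by
  have h1 : Integrable (fun ω => a * X ω) μ := by
    simpa using (integrable_pow_of_ae_mem_Icc hX hX0 hXu 1).const_mul a
  have h2 : Integrable (fun ω => b * X ω ^ 2) μ :=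
    (integrable_pow_of_ae_mem_Icc hX hX0 hXu 2).const_mul b
  have h3 : Integrable (fun ω => 1 + a * X ω) μ := (integrable_const 1).add h1
  refine ⟨h3.add h2, ?_⟩
  rw [integral_add h3 h2, integral_add (integrable_const 1) h1, integral_const_mul,
    integral_const_mul]
  simp

/-- A priori bound for the solution `η` of `E[exp (-η X)] = exp (-τ)` with small `τ`. -/
lemma abs_le_of_integral_exp_neg_eq (hX : Measurable X) (hX0 : ∀ᵐ ω ∂μ, 0 ≤ X ω)
    (hXu : ∀ ω, X ω ≤ u) {M η τ a : ℝ} (hm1 : 1 / 2 ≤ ∫ ω, X ω ∂μ)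
    (hm2 : ∫ ω, X ω ^ 2 ∂μ ≤ M) (ha : 0 < a) (ha1 : a ≤ 1) (haM : a * M ≤ 1 / 2)
    (hτ : |τ| ≤ a / 8) (hη : ∫ ω, Real.exp (-η * X ω) ∂μ = Real.exp (-τ)) : |η| ≤ a := by
  obtain ⟨hτ1, hτ2⟩ := abs_le.1 hτ
  rw [abs_le]
  constructor
  · obtain ⟨hi, he⟩ := integral_quadratic_of_ae_mem_Icc hX hX0 hXu (-η) 0
    have h := integral_mono hi (integrable_exp_mul_of_ae_mem_Icc hX hX0 hXu (-η))
      (fun ω => by have := Real.add_one_le_exp (-η * X ω); simp only; linarith)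
    rw [he, hη] at h
    have h2 : Real.exp (-τ) ≤ 1 + a / 4 := by
      have := Real.exp_bound_div_one_sub_of_interval (x := a / 8) (by linarith) (by linarith)
      have h3 : Real.exp (-τ) ≤ Real.exp (a / 8) := Real.exp_le_exp.2 (by linarith)
      refine h3.trans (this.trans ?_)
      rw [div_le_iff₀ (by linarith)]
      nlinarith
    by_contra! hc
    nlinarith
  · by_contra! hc
    obtain ⟨hi, he⟩ := integral_quadratic_of_ae_mem_Icc hX hX0 hXu (-a) (a ^ 2 / 2)
    have h : ∫ ω, Real.exp (-η * X ω) ∂μ ≤ ∫ ω, (1 + -a * X ω + a ^ 2 / 2 * X ω ^ 2) ∂μ := by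
      refine integral_mono_ae (integrable_exp_mul_of_ae_mem_Icc hX hX0 hXu (-η)) hi ?_
      filter_upwards [hX0] with ω h0
      have h1 := Real.exp_neg_le_quadratic (mul_nonneg ha.le h0)
      have h2 : Real.exp (-η * X ω) ≤ Real.exp (-(a * X ω)) :=
        Real.exp_le_exp.2 (by nlinarith)
      linarith [mul_pow a (X ω) 2]
    rw [he, hη] at h
    have h4 := Real.add_one_le_exp (-τ)
    have h5 : a ^ 2 / 2 * ∫ ω, X ω ^ 2 ∂μ ≤ a / 4 := by
      have := mul_le_mul_of_nonneg_left hm2 (by positivity : 0 ≤ a ^ 2 / 2)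
      nlinarith
    nlinarith

lemma abs_integral_exp_neg_sub_quadratic_le (hX : Measurable X) (hX0 : ∀ᵐ ω ∂μ, 0 ≤ X ω)
    (hXu : ∀ ω, X ω ≤ u) (η : ℝ) :
    |∫ ω, Real.exp (-η * X ω) ∂μ - (1 - η * ∫ ω, X ω ∂μ + η ^ 2 / 2 * ∫ ω, X ω ^ 2 ∂μ)|
      ≤ |η| ^ 3 * Real.exp (|η| * u) * ∫ ω, X ω ^ 3 ∂μ := by
  obtain ⟨hi, he⟩ := integral_quadratic_of_ae_mem_Icc hX hX0 hXu (-η) (η ^ 2 / 2)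
  have h1 : 1 - η * ∫ ω, X ω ∂μ + η ^ 2 / 2 * ∫ ω, X ω ^ 2 ∂μ
      = ∫ ω, (1 + -η * X ω + η ^ 2 / 2 * X ω ^ 2) ∂μ := by rw [he]; ring
  rw [h1, ← integral_sub (integrable_exp_mul_of_ae_mem_Icc hX hX0 hXu (-η)) hi,
    ← integral_const_mul, ← Real.norm_eq_abs]
  refine norm_integral_le_of_norm_le
    ((integrable_pow_of_ae_mem_Icc hX hX0 hXu 3).const_mul _) ?_
  filter_upwards [hX0] with ω h0
  have h2 := Real.abs_exp_sub_quadratic_le (-η * X ω)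
  have h3 : |-η * X ω| = |η| * X ω := by rw [abs_mul, abs_neg, abs_of_nonneg h0]
  have h4 : Real.exp (|η| * X ω) ≤ Real.exp (|η| * u) :=
    Real.exp_le_exp.2 (mul_le_mul_of_nonneg_left (hXu ω) (abs_nonneg η))
  rw [h3] at h2
  rw [Real.norm_eq_abs]
  calc _ = |Real.exp (-η * X ω) - (1 + -η * X ω + (-η * X ω) ^ 2 / 2)| := by
        congr 1; ring
    _ ≤ (|η| * X ω) ^ 3 * Real.exp (|η| * X ω) := h2
    _ ≤ (|η| * X ω) ^ 3 * Real.exp (|η| * u) := by gcongr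
    _ = _ := by ring

end BoundedVariable

lemma sub_min_le_cube_div {t u : ℝ} (ht : 0 < t) (hu : 0 < u) :
    t - min t u ≤ t ^ 3 / u ^ 2 := by
  rcases le_total t u with h | h
  · rw [min_eq_left h, sub_self]; positivity
  · rw [min_eq_right h, le_div_iff₀ (by positivity)]
    nlinarith [mul_le_mul_of_nonneg_left (pow_le_pow_left₀ hu.le h 2) ht.le, pow_pos hu 3]

lemma sq_sub_min_sq_le_cube_div {t u : ℝ} (ht : 0 < t) (hu : 0 < u) :
    t ^ 2 - min t u ^ 2 ≤ t ^ 3 / u := by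
  rcases le_total t u with h | h
  · rw [min_eq_left h, sub_self]; positivity
  · rw [min_eq_right h, le_div_iff₀ (by positivity)]
    nlinarith [mul_le_mul_of_nonneg_left h (sq_nonneg t), pow_pos hu 3]

lemma truncated_moment_bounds {Ω : Type*} [MeasurableSpace Ω] {μ : Measure Ω}
    [IsProbabilityMeasure μ] {T : Ω → ℝ} (hT : Measurable T) (hT0 : ∀ᵐ ω ∂μ, 0 < T ω)
    (h1 : Integrable T μ) (h2 : Integrable (fun ω => T ω ^ 2) μ)
    (h3 : Integrable (fun ω => T ω ^ 3) μ) {u : ℝ} (hu : 0 < u) :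
    |∫ ω, T ω ∂μ - ∫ ω, min (T ω) u ∂μ| ≤ (∫ ω, T ω ^ 3 ∂μ) / u ^ 2 ∧
    |∫ ω, T ω ^ 2 ∂μ - ∫ ω, min (T ω) u ^ 2 ∂μ| ≤ (∫ ω, T ω ^ 3 ∂μ) / u ∧
    ∫ ω, min (T ω) u ^ 2 ∂μ ≤ ∫ ω, T ω ^ 2 ∂μ ∧
    ∫ ω, min (T ω) u ^ 3 ∂μ ≤ ∫ ω, T ω ^ 3 ∂μ := by
  have hX : Measurable (fun ω => min (T ω) u) := hT.min measurable_const
  have hX0 : ∀ᵐ ω ∂μ, 0 ≤ min (T ω) u := hT0.mono fun ω h => (lt_min h hu).le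
  have hI := integrable_pow_of_ae_mem_Icc hX hX0 (fun ω => min_le_right _ _)
  have hI1 : Integrable (fun ω => min (T ω) u) μ := by simpa using hI 1
  refine ⟨?_, ?_, ?_, ?_⟩
  · rw [← integral_sub h1 hI1, ← integral_div, ← Real.norm_eq_abs]
    refine norm_integral_le_of_norm_le (h3.div_const _) ?_
    filter_upwards [hT0] with ω h
    rw [Real.norm_of_nonneg (sub_nonneg.2 (min_le_left _ _))]
    exact sub_min_le_cube_div h hu
  · rw [← integral_sub h2 (hI 2), ← integral_div, ← Real.norm_eq_abs]
    refine norm_integral_le_of_norm_le (h3.div_const _) ?_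
    filter_upwards [hT0, hX0] with ω h h0
    rw [Real.norm_of_nonneg (sub_nonneg.2 (pow_le_pow_left₀ h0 (min_le_left _ _) 2))]
    exact sq_sub_min_sq_le_cube_div h hu
  · refine integral_mono_ae (hI 2) h2 ?_
    filter_upwards [hX0] with ω h0
    exact pow_le_pow_left₀ h0 (min_le_left _ _) 2
  · refine integral_mono_ae (hI 3) h3 ?_
    filter_upwards [hX0] with ω h0
    exact pow_le_pow_left₀ h0 (min_le_left _ _) 3

/-- Second-order inversion of `E[exp (-η X)] = exp (-θ s)`, where the first three moments of `X`
approximate `1`, `M` and a bounded quantity, as `s → 0`. -/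
lemma exists_expansion_of_moments (θ M K A : ℝ) (hM : 0 ≤ M) (hK : 0 ≤ K) (hA : 0 ≤ A) :
    ∃ E ≥ (0 : ℝ), ∃ F ≥ (0 : ℝ), ∀ s η m₁ m₂ m₃ L : ℝ, 0 < s → s ≤ 1 → |η| ≤ A * s →
      |1 - m₁| ≤ K * s ^ 2 → |M - m₂| ≤ K * s → m₃ ≤ K →
      |L - (1 - η * m₁ + η ^ 2 / 2 * m₂)| ≤ |η| ^ 3 * Real.exp A * m₃ →
      L = Real.exp (-(θ * s)) →
      |η ^ 2 - (θ * s) ^ 2| ≤ E * s ^ 3 ∧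
      |η - (θ * s + (θ * s) ^ 2 * (M - 1) / 2)| ≤ F * s ^ 3 := by
  set D := A * K + A ^ 2 * K / 2 + A ^ 3 * Real.exp A * K + |θ| ^ 3 * Real.exp |θ| with hD
  set G := D + A ^ 2 * M / 2 + θ ^ 2 / 2 with hG
  have hD0 : 0 ≤ D := by positivity
  have hG0 : 0 ≤ G := by positivity
  refine ⟨G * (A + |θ|), by positivity, D + M / 2 * (G * (A + |θ|)), by positivity, ?_⟩
  intro s η m₁ m₂ m₃ L hs hs1 hη h1 h2 h3 hL hLe
  have hη3 : |η| ^ 3 * Real.exp A * m₃ ≤ A ^ 3 * Real.exp A * K * s ^ 3 := by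
    calc _ ≤ |η| ^ 3 * Real.exp A * K := by gcongr
      _ ≤ (A * s) ^ 3 * Real.exp A * K := by gcongr
      _ = _ := by ring
  have hη2 : η ^ 2 ≤ A ^ 2 * s ^ 2 := by
    rw [← sq_abs, ← mul_pow]; gcongr
  have hR : |Real.exp (-(θ * s)) - (1 - θ * s + (θ * s) ^ 2 / 2)|
      ≤ |θ| ^ 3 * Real.exp |θ| * s ^ 3 := by
    have h := Real.abs_exp_sub_quadratic_le (-(θ * s))
    have hab : |-(θ * s)| = |θ| * s := by rw [abs_neg, abs_mul, abs_of_pos hs]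
    rw [hab] at h
    calc _ = |Real.exp (-(θ * s)) - (1 + -(θ * s) + (-(θ * s)) ^ 2 / 2)| := by congr 1; ring
      _ ≤ (|θ| * s) ^ 3 * Real.exp (|θ| * s) := h
      _ ≤ (|θ| * s) ^ 3 * Real.exp |θ| := by
        gcongr
        exact mul_le_of_le_one_right (abs_nonneg θ) hs1
      _ = _ := by ring
  have e1 : |η * (1 - m₁)| ≤ A * K * s ^ 3 := by
    rw [abs_mul]
    calc _ ≤ (A * s) * (K * s ^ 2) := by gcongr
      _ = _ := by ring
  have e2 : |η ^ 2 / 2 * (M - m₂)| ≤ A ^ 2 * K / 2 * s ^ 3 := by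
    rw [abs_mul, abs_of_nonneg (by positivity : 0 ≤ η ^ 2 / 2)]
    calc _ ≤ (A ^ 2 * s ^ 2) / 2 * (K * s) := by gcongr
      _ = _ := by ring
  have hmain : |η - η ^ 2 * M / 2 - θ * s + (θ * s) ^ 2 / 2| ≤ D * s ^ 3 := by
    have e3 := hL.trans hη3
    rw [hLe] at e3
    rw [abs_le] at e1 e2 e3 hR ⊢
    rw [hD]
    constructor <;> linarith
  have hs3 : s ^ 3 ≤ s ^ 2 := pow_le_pow_of_le_one hs.le hs1 (by norm_num)
  have hfirst : |η - θ * s| ≤ G * s ^ 2 := by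
    have f1 : D * s ^ 3 ≤ D * s ^ 2 := by gcongr
    have f2 : η ^ 2 * M ≤ A ^ 2 * s ^ 2 * M := by gcongr
    have f3 : 0 ≤ η ^ 2 * M := by positivity
    have f4 : 0 ≤ θ ^ 2 * s ^ 2 := by positivity
    have f5 : 0 ≤ A ^ 2 * s ^ 2 * M := by positivity
    rw [abs_le] at hmain ⊢
    rw [hG]
    constructor <;> nlinarith
  have hsq : |η ^ 2 - (θ * s) ^ 2| ≤ G * (A + |θ|) * s ^ 3 := by
    have g1 : |η + θ * s| ≤ (A + |θ|) * s := by
      refine (abs_add_le _ _).trans ?_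
      rw [abs_mul, abs_of_pos hs]
      linarith
    calc _ = |η - θ * s| * |η + θ * s| := by rw [← abs_mul]; congr 1; ring
      _ ≤ (G * s ^ 2) * ((A + |θ|) * s) := by gcongr
      _ = _ := by ring
  refine ⟨hsq, ?_⟩
  have g2 : |M / 2 * (η ^ 2 - (θ * s) ^ 2)| ≤ M / 2 * (G * (A + |θ|)) * s ^ 3 := by
    rw [abs_mul, abs_of_nonneg (by positivity : 0 ≤ M / 2), mul_assoc]
    gcongr
  rw [abs_le] at g2 hmain ⊢
  constructor <;> linarith

lemma abs_exp_neg_mul_sub_le {E F A s η r t v : ℝ} (hA : 0 ≤ A) (hs : 0 < s)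
    (hη : |η| ≤ A * s) (hE : |η ^ 2 - t ^ 2| ≤ E * s ^ 3)
    (hF : |η - (t + t ^ 2 * v / 2)| ≤ F * s ^ 3) (hr : 0 ≤ r) (hrs : r * s ≤ 1) :
    |Real.exp (-η * r) - (1 - t * r - 1 / 2 * t ^ 2 * (v * r - r ^ 2))|
      ≤ F * s ^ 3 * r + E * s ^ 3 * r ^ 2 / 2 + A ^ 3 * Real.exp A * s ^ 3 * r ^ 3 := by
  have h := Real.abs_exp_sub_quadratic_le (-η * r)
  have hab : |-η * r| ≤ A * s * r := by
    rw [abs_mul, abs_neg, abs_of_nonneg hr]; gcongr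
  have hab' : |-η * r| ≤ A := hab.trans (by nlinarith)
  have h3 : |-η * r| ^ 3 * Real.exp |-η * r| ≤ A ^ 3 * Real.exp A * s ^ 3 * r ^ 3 := by
    calc _ ≤ (A * s * r) ^ 3 * Real.exp A := by gcongr
      _ = _ := by ring
  have h4 : |(η - (t + t ^ 2 * v / 2)) * r| ≤ F * s ^ 3 * r := by
    rw [abs_mul, abs_of_nonneg hr]; gcongr
  have h5 : |(η ^ 2 - t ^ 2) * (r ^ 2 / 2)| ≤ E * s ^ 3 * (r ^ 2 / 2) := by
    rw [abs_mul, abs_of_nonneg (by positivity : 0 ≤ r ^ 2 / 2)]; gcongr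
  have h6 := h.trans h3
  rw [abs_le] at h4 h5 h6 ⊢
  constructor <;> linarith

/-- Lemma 4.9 (`SDQ-asymp 2`), expansion (4.22): uniform second-order Taylor expansion
of `e^{−η⁽ⁿ⁾(n^{−1/2}θ) r}` for `0 ≤ r ≤ √n`, with error `O((r + r² + r³) n^{−3/2})`. -/
theorem stmt9
    {Ω : Type*} [MeasurableSpace Ω] (μ : Measure Ω) [IsProbabilityMeasure μ]
    (T : Ω → ℝ) (hT_meas : Measurable T)
    (hT_pos : ∀ᵐ ω ∂μ, 0 < T ω)
    (hT_mean : ∫ ω, T ω ∂μ = 1)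
    (hT3 : Integrable (fun ω => (T ω) ^ 3) μ)
    (σ2 : ℝ) (hσ2 : σ2 = ∫ ω, (T ω - 1) ^ 2 ∂μ)
    (eta : ℕ → ℝ → ℝ)
    (heta : ∀ n : ℕ, 1 ≤ n → ∀ θ : ℝ,
      Real.exp θ * ∫ ω, Real.exp (-(eta n θ) * min (T ω) (Real.sqrt (n : ℝ))) ∂μ = 1) :
    ∀ θ : ℝ, ∃ C > (0:ℝ), ∃ n₀ : ℕ, 1 ≤ n₀ ∧
      ∀ n : ℕ, n₀ ≤ n → ∀ r : ℝ, 0 ≤ r → r ≤ Real.sqrt (n : ℝ) →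
        |Real.exp (-(eta n (θ / Real.sqrt (n : ℝ))) * r)
            - (1 - θ / Real.sqrt (n : ℝ) * r
                - 1 / 2 * (θ ^ 2 / (n : ℝ)) * (σ2 * r - r ^ 2))|
          ≤ C * (r + r ^ 2 + r ^ 3) / (n : ℝ) ^ ((3 : ℝ) / 2) := by
  intro θ
  have hT1 : Integrable T μ := by
    by_contra h
    rw [integral_undef h] at hT_mean
    norm_num at hT_mean
  have hT2 : Integrable (fun ω => T ω ^ 2) μ := by
    refine (hT1.add hT3).mono' (hT_meas.pow_const 2).aestronglyMeasurable ?_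
    filter_upwards [hT_pos] with ω h
    rw [Real.norm_of_nonneg (by positivity)]
    simp only [Pi.add_apply]
    nlinarith [mul_nonneg h.le (sq_nonneg (T ω - 1)), pow_pos h 3]
  set M := ∫ ω, T ω ^ 2 ∂μ with hMdef
  set K := ∫ ω, T ω ^ 3 ∂μ with hKdef
  have hM : 0 ≤ M := integral_nonneg fun ω => sq_nonneg _
  have hK : 0 ≤ K := integral_nonneg_of_ae (hT_pos.mono fun ω h => pow_nonneg h.le 3)
  have hσ : σ2 = M - 1 := by
    have h1 : ∀ ω, (T ω - 1) ^ 2 = T ω ^ 2 - (2 * T ω - 1) := fun ω => by ring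
    simp_rw [hσ2, h1]
    have h2 : Integrable (fun ω => 2 * T ω - 1) μ := (hT1.const_mul 2).sub (integrable_const 1)
    rw [integral_sub hT2 h2, integral_sub (hT1.const_mul 2) (integrable_const 1), integral_const_mul, hT_mean]
    simp only [integral_const, probReal_univ, one_smul]
    rw [← hMdef]
    norm_num
  set A := 8 * (|θ| + 1) with hAdef
  have hA : 0 < A := by positivity
  clear_value A M K
  obtain ⟨E, hE0, F, hF0, hEF⟩ := exists_expansion_of_moments θ M K A hM hK hA.le
  have hlim : Tendsto (fun n : ℕ => (Real.sqrt (n : ℝ))⁻¹) atTop (nhds 0) :=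
    (Real.tendsto_sqrt_atTop.comp tendsto_natCast_atTop_atTop).inv_tendsto_atTop
  set δ := (A * (M + 1) + K + 1)⁻¹ / 2 with hδdef
  have hδ : 0 < δ := by positivity
  obtain ⟨N, hN⟩ := eventually_atTop.1 (hlim.eventually (gt_mem_nhds hδ))
  refine ⟨F + E + A ^ 3 * Real.exp A, by positivity, max N 1, le_max_right _ _, ?_⟩
  intro n hn r hr hru
  have hn1 : 1 ≤ n := (le_max_right _ _).trans hn
  have hsδ := hN n ((le_max_left _ _).trans hn)
  have hn0 : (0 : ℝ) < n := by exact_mod_cast hn1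
  set u := Real.sqrt (n : ℝ) with hudef
  have hu : 0 < u := Real.sqrt_pos.2 hn0
  have hun : u ^ 2 = n := Real.sq_sqrt hn0.le
  set s := u⁻¹ with hsdef
  have hs : 0 < s := inv_pos.2 hu
  have hus : u * s = 1 := mul_inv_cancel₀ hu.ne'
  have hsum : (A * (M + 1) + K + 1) * s ≤ 1 / 2 := by
    calc _ ≤ (A * (M + 1) + K + 1) * δ := by gcongr
      _ = 1 / 2 := by rw [hδdef]; field_simp
  have hAM0 : 0 ≤ A * M * s := by positivity
  have hAs : 0 < A * s := by positivity
  have hK0 : 0 ≤ K * s := by positivity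
  have hs1 : s ≤ 1 := by linarith
  set η := eta n (θ / u) with hηdef
  have hθs : θ / u = θ * s := div_eq_mul_inv _ _
  have hL : ∫ ω, Real.exp (-η * min (T ω) u) ∂μ = Real.exp (-(θ * s)) := by
    have h := heta n hn1 (θ / u)
    rw [Real.exp_neg, ← hθs]
    exact eq_inv_of_mul_eq_one_right h
  have hX : Measurable (fun ω => min (T ω) u) := hT_meas.min measurable_const
  have hX0 : ∀ᵐ ω ∂μ, 0 ≤ min (T ω) u := hT_pos.mono fun ω h => (lt_min h hu).le
  have hXu : ∀ ω, min (T ω) u ≤ u := fun ω => min_le_right _ _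
  obtain ⟨b1, b2, b3, b4⟩ := truncated_moment_bounds hT_meas hT_pos hT1 hT2 hT3 hu
  rw [hT_mean, ← hKdef, div_eq_mul_inv, ← inv_pow, ← hsdef] at b1
  rw [← hMdef, ← hKdef, div_eq_mul_inv, ← hsdef] at b2
  rw [← hMdef] at b3
  rw [← hKdef] at b4
  have hm1 : 1 / 2 ≤ ∫ ω, min (T ω) u ∂μ := by
    have h1 := (abs_le.1 b1).2
    have h2 : K * s ^ 2 ≤ K * s := by
      have : s ^ 2 ≤ s := by nlinarith
      gcongr
    linarith
  have hη : |η| ≤ A * s := by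
    refine abs_le_of_integral_exp_neg_eq hX hX0 hXu hm1 b3 hAs (by linarith)
      (by linarith) ?_ hL
    rw [abs_mul, abs_of_pos hs, hAdef]
    linarith
  have hquad := abs_integral_exp_neg_sub_quadratic_le hX hX0 hXu η
  have hηu : |η| * u ≤ A := by
    calc _ ≤ A * s * u := by gcongr
      _ = A := by rw [mul_assoc, mul_comm s u, hus, mul_one]
  have hm3 : 0 ≤ ∫ ω, min (T ω) u ^ 3 ∂μ :=
    integral_nonneg_of_ae (hX0.mono fun ω h => pow_nonneg h 3)
  obtain ⟨c1, c2⟩ := hEF s η _ _ _ _ hs hs1 hη b1 b2 b4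
    (hquad.trans (by gcongr)) hL
  have hrs : r * s ≤ 1 := by
    rw [← hus]; gcongr
  have hfin := abs_exp_neg_mul_sub_le hA.le hs hη c1 c2 hr hrs
  have hn32 : (n : ℝ) ^ ((3 : ℝ) / 2) = u ^ 3 := by
    rw [hudef, Real.sqrt_eq_rpow, ← Real.rpow_natCast, ← Real.rpow_mul hn0.le]
    norm_num
  have hsq : θ ^ 2 / (n : ℝ) = (θ * s) ^ 2 := by
    rw [← hun, mul_pow, hsdef, inv_pow, div_eq_mul_inv]
  rw [hn32, hsq, hθs, hσ]
  refine hfin.trans ?_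
  rw [div_eq_mul_inv _ (u ^ 3), ← inv_pow, ← hsdef]
  have p1 : 0 ≤ F * s ^ 3 * (r ^ 2 + r ^ 3) := by positivity
  have p2 : 0 ≤ E * s ^ 3 * (r + r ^ 2 / 2 + r ^ 3) := by positivity
  have p3 : 0 ≤ A ^ 3 * Real.exp A * s ^ 3 * (r + r ^ 2) := by positivity
  linarith
end

section
/- Let ξ be a finite Borel measure on [0,∞) and β : [0,∞) → ℝ a bounded Borel measurable function with β* = sup_{u} |β(u)|. Suppose that for every θ ≤ 0 and every x ≥ 0: ∫_{[0,x]} (β(u)+θ)·e^{θu} dξ(u) = ∫_{[0,∞)} β(u) dξ(u) − e^{θx}·∫_{(x,∞)} β(u) dξ(u). Then ξ((x,y]) ≤ β*·(y − x)·ξ([0,∞)) for all 0 ≤ x < y; in particular, the restriction of ξ to (0,∞) is absolutely continuous with respect to Lebesgue measure. -/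
open MeasureTheory Filter Set

/-- A measure on `ℝ` giving mass at most `C * (b - a)` to each `Ioc a b` is dominated by
`C • volume`. -/
theorem measure_le_smul_volume_of_Ioc_le {ρ : Measure ℝ} {C : ENNReal} (hC : C ≠ ⊤)
    (h : ∀ a b : ℝ, ρ (Ioc a b) ≤ C * ENNReal.ofReal (b - a)) : ρ ≤ C • volume := by
  have houter : ρ.toOuterMeasure ≤ C • StieltjesFunction.id.outer := by
    rw [StieltjesFunction.outer, OuterMeasure.smul_ofFunction hC, OuterMeasure.le_ofFunction]
    intro s
    have hbot : (botSet : Set ℝ) = ∅ :=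
      eq_empty_of_forall_notMem fun x => notMem_botSet_of_lt (sub_one_lt x)
    rw [Pi.smul_apply, smul_eq_mul, StieltjesFunction.length_eq, hbot, sdiff_empty]
    rcases eq_or_ne C 0 with rfl | hC0
    · have hIoc : ∀ n : ℕ, ρ (Ioc (-(n : ℝ)) n) = 0 := fun n => by simpa using h (-(n : ℝ)) n
      have hsub : s ⊆ ⋃ n : ℕ, Ioc (-(n : ℝ)) n := fun x _ => by
        obtain ⟨n, hn⟩ := exists_nat_gt |x|
        exact mem_iUnion.2 ⟨n, (abs_lt.1 hn).1, (abs_lt.1 hn).2.le⟩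
      simpa using measure_mono_null hsub (measure_iUnion_null hIoc)
    · simp only [ENNReal.mul_iInf_of_ne hC0 hC]
      exact le_iInf fun a => le_iInf fun b => le_iInf fun hs => (measure_mono hs).trans (h a b)
  refine Measure.le_iff'.2 fun s => ?_
  rw [Real.volume_eq_stieltjes_id, StieltjesFunction.measure]
  exact houter s

/-- The exponentially weighted form of the Lipschitz bound, at a fixed parameter `-s < 0`. -/
theorem exp_mul_measureReal_Ioc_le
    {ξ : Measure ℝ} [IsFiniteMeasure ξ] (hsupp : ξ (Iio 0) = 0)
    {β : ℝ → ℝ} (hβ_meas : Measurable β)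
    {βstar : ℝ} (hβstar : ∀ u : ℝ, 0 ≤ u → |β u| ≤ βstar)
    (hBAR : ∀ θ : ℝ, θ ≤ 0 → ∀ x : ℝ, 0 ≤ x →
      ∫ u in Icc 0 x, (β u + θ) * Real.exp (θ * u) ∂ξ
        = (∫ u in Ici 0, β u ∂ξ) - Real.exp (θ * x) * ∫ u in Ioi x, β u ∂ξ)
    {x y s : ℝ} (hx : 0 ≤ x) (hxy : x < y) (hs : 0 < s) :
    Real.exp (-s * y) * ξ.real (Ioc x y)
      ≤ Real.exp (-s * x) * (βstar * (y - x) * ξ.real (Ici 0)) := by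
  have hβ0 : 0 ≤ βstar := (abs_nonneg _).trans (hβstar 0 le_rfl)
  have hpos : ∀ᵐ u ∂ξ, 0 ≤ u := by
    rw [ae_iff]
    simpa [Iio] using hsupp
  have hβi : Integrable β ξ :=
    Integrable.of_bound hβ_meas.aestronglyMeasurable βstar
      (hpos.mono fun u hu => hβstar u hu)
  have hei : Integrable (fun u => Real.exp (-s * u)) ξ := by
    refine Integrable.of_bound (by fun_prop) 1 (hpos.mono fun u hu => ?_)
    rw [Real.norm_of_nonneg (Real.exp_pos _).le, Real.exp_le_one_iff]
    nlinarith
  have hβei : Integrable (fun u => β u * Real.exp (-s * u)) ξ := by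
    refine Integrable.of_bound (by fun_prop) βstar (hpos.mono fun u hu => ?_)
    rw [norm_mul, Real.norm_of_nonneg (Real.exp_pos _).le]
    have h1 : Real.exp (-s * u) ≤ 1 := Real.exp_le_one_iff.2 (by nlinarith)
    exact (mul_le_of_le_one_right (norm_nonneg _) h1).trans (hβstar u hu)
  have hfi : Integrable (fun u => (β u + -s) * Real.exp (-s * u)) ξ := by
    simp only [add_mul]
    exact hβei.add (hei.const_mul (-s))
  have hIcc : ∫ u in Icc 0 y, (β u + -s) * Real.exp (-s * u) ∂ξ
      = (∫ u in Icc 0 x, (β u + -s) * Real.exp (-s * u) ∂ξ)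
        + ∫ u in Ioc x y, (β u + -s) * Real.exp (-s * u) ∂ξ := by
    rw [← Icc_union_Ioc_eq_Icc hx hxy.le]
    exact setIntegral_union (disjoint_left.2 fun u h1 h2 => h2.1.not_ge h1.2)
      measurableSet_Ioc hfi.integrableOn hfi.integrableOn
  have hIoi : ∫ u in Ioi x, β u ∂ξ = (∫ u in Ioc x y, β u ∂ξ) + ∫ u in Ioi y, β u ∂ξ := by
    rw [← Ioc_union_Ioi_eq_Ioi hxy.le]
    exact setIntegral_union (disjoint_left.2 fun u h1 h2 => (mem_Ioi.1 h2).not_ge h1.2)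
      measurableSet_Ioi hβi.integrableOn hβi.integrableOn
  have hsplit : ∫ u in Ioc x y, (β u + -s) * Real.exp (-s * u) ∂ξ
      = (∫ u in Ioc x y, β u * Real.exp (-s * u) ∂ξ)
        - s * ∫ u in Ioc x y, Real.exp (-s * u) ∂ξ := by
    rw [← integral_const_mul, ← integral_sub hβei.integrableOn (hei.const_mul s).integrableOn]
    exact integral_congr_ae (.of_forall fun u => by ring)
  have hdiff : ∫ u in Ioc x y, (Real.exp (-s * x) - Real.exp (-s * u)) * β u ∂ξ
      = Real.exp (-s * x) * (∫ u in Ioc x y, β u ∂ξ)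
        - ∫ u in Ioc x y, β u * Real.exp (-s * u) ∂ξ := by
    rw [← integral_const_mul,
      ← integral_sub (hβi.const_mul (Real.exp (-s * x))).integrableOn hβei.integrableOn]
    exact integral_congr_ae (.of_forall fun u => by ring)
  have hbarx := hBAR (-s) (by linarith) x hx
  have hbary := hBAR (-s) (by linarith) y (hx.trans hxy.le)
  set D := Real.exp (-s * x) - Real.exp (-s * y) with hD
  have hD0 : 0 ≤ D := sub_nonneg.2 (Real.exp_le_exp.2 (by nlinarith))
  have hkey : s * ∫ u in Ioc x y, Real.exp (-s * u) ∂ξ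
      = -(D * ∫ u in Ioi y, β u ∂ξ)
        - ∫ u in Ioc x y, (Real.exp (-s * x) - Real.exp (-s * u)) * β u ∂ξ := by
    rw [hdiff, hD]
    rw [hIoi] at hbarx
    linarith
  have htail : |∫ u in Ioi y, β u ∂ξ| ≤ βstar * ξ.real (Ioi y) := by
    rw [← Real.norm_eq_abs]
    refine norm_setIntegral_le_of_norm_le_const (measure_lt_top ξ _) fun u hu => ?_
    exact hβstar u (hx.trans (hxy.trans hu).le)
  have hmid : |∫ u in Ioc x y, (Real.exp (-s * x) - Real.exp (-s * u)) * β u ∂ξ|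
      ≤ D * βstar * ξ.real (Ioc x y) := by
    rw [← Real.norm_eq_abs]
    refine norm_setIntegral_le_of_norm_le_const (measure_lt_top ξ _) fun u hu => ?_
    have h1 : Real.exp (-s * u) ≤ Real.exp (-s * x) :=
      Real.exp_le_exp.2 (by nlinarith [hu.1])
    have h2 : Real.exp (-s * y) ≤ Real.exp (-s * u) :=
      Real.exp_le_exp.2 (by nlinarith [hu.2])
    rw [norm_mul, Real.norm_of_nonneg (sub_nonneg.2 h1)]
    exact mul_le_mul (by linarith) (hβstar u (hx.trans hu.1.le)) (norm_nonneg _) hD0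
  have hmass : ξ.real (Ioc x y) + ξ.real (Ioi y) ≤ ξ.real (Ici 0) := by
    rw [← measureReal_union (disjoint_left.2 fun u h1 h2 => (mem_Ioi.1 h2).not_ge h1.2)
      measurableSet_Ioi, Ioc_union_Ioi_eq_Ioi hxy.le]
    exact measureReal_mono fun u hu => hx.trans (le_of_lt hu)
  have hlower : Real.exp (-s * y) * ξ.real (Ioc x y) ≤ ∫ u in Ioc x y, Real.exp (-s * u) ∂ξ := by
    have := setIntegral_mono_on (μ := ξ) (s := Ioc x y)
      (f := fun _ => Real.exp (-s * y)) (g := fun u => Real.exp (-s * u))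
      (integrable_const _) hei.integrableOn measurableSet_Ioc
      (fun u hu => Real.exp_le_exp.2 (by nlinarith [hu.2]))
    simpa [mul_comm] using this
  have hDle : D ≤ s * (y - x) * Real.exp (-s * x) := by
    have h1 := Real.add_one_le_exp (-s * (y - x))
    have h2 : Real.exp (-s * y) = Real.exp (-s * (y - x)) * Real.exp (-s * x) := by
      rw [← Real.exp_add]; ring_nf
    rw [hD, h2]
    nlinarith [Real.exp_pos (-s * x)]
  refine le_of_mul_le_mul_left ?_ hs
  calc s * (Real.exp (-s * y) * ξ.real (Ioc x y))
      ≤ s * ∫ u in Ioc x y, Real.exp (-s * u) ∂ξ := mul_le_mul_of_nonneg_left hlower hs.le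
    _ ≤ D * (βstar * ξ.real (Ioi y)) + D * βstar * ξ.real (Ioc x y) := by
        rw [hkey]
        have h1 := mul_le_mul_of_nonneg_left ((neg_le_abs _).trans htail) hD0
        have h2 := (neg_le_abs _).trans hmid
        linarith
    _ = D * (βstar * (ξ.real (Ioc x y) + ξ.real (Ioi y))) := by ring
    _ ≤ D * (βstar * ξ.real (Ici 0)) := by gcongr
    _ ≤ s * (y - x) * Real.exp (-s * x) * (βstar * ξ.real (Ici 0)) := by gcongr
    _ = s * (Real.exp (-s * x) * (βstar * (y - x) * ξ.real (Ici 0))) := by ring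

/-- From the proof of Lemma 5.1 (`Ln-x01`), via equation (5.5)/(5.8): a finite measure
`ξ` on `[0,∞)` satisfying the limiting BAR identity is Lipschitz in the sense
`ξ((x,y]) ≤ β* (y − x) ξ([0,∞))`, hence absolutely continuous on `(0,∞)`. -/
theorem stmt10
    (ξ : Measure ℝ) [IsFiniteMeasure ξ] (hsupp : ξ (Iio 0) = 0)
    (β : ℝ → ℝ) (hβ_meas : Measurable β)
    (βstar : ℝ) (hβstar : ∀ u : ℝ, 0 ≤ u → |β u| ≤ βstar)
    (hBAR : ∀ θ : ℝ, θ ≤ 0 → ∀ x : ℝ, 0 ≤ x →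
      ∫ u in Icc 0 x, (β u + θ) * Real.exp (θ * u) ∂ξ
        = (∫ u in Ici 0, β u ∂ξ) - Real.exp (θ * x) * ∫ u in Ioi x, β u ∂ξ) :
    (∀ x y : ℝ, 0 ≤ x → x < y →
      (ξ (Ioc x y)).toReal ≤ βstar * (y - x) * (ξ (Ici 0)).toReal) ∧
    ξ.restrict (Ioi 0) ≪ volume := by
  have hlip : ∀ x y : ℝ, 0 ≤ x → x < y →
      (ξ (Ioc x y)).toReal ≤ βstar * (y - x) * (ξ (Ici 0)).toReal := by
    intro x y hx hxy
    have hlim : ∀ c d : ℝ, Tendsto (fun s : ℝ => Real.exp (-s * c) * d)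
        (nhdsWithin 0 (Ioi 0)) (nhds d) := fun c d => by
      have hcont : Continuous fun s : ℝ => Real.exp (-s * c) * d := by fun_prop
      simpa using (hcont.tendsto 0).mono_left nhdsWithin_le_nhds
    exact le_of_tendsto_of_tendsto (hlim y _) (hlim x _) <|
      eventually_mem_nhdsWithin.mono fun s hs =>
        exp_mul_measureReal_Ioc_le hsupp hβ_meas hβstar hBAR hx hxy hs
  refine ⟨hlip, ?_⟩
  have hβ0 : 0 ≤ βstar := (abs_nonneg _).trans (hβstar 0 le_rfl)
  have hC : 0 ≤ βstar * (ξ (Ici 0)).toReal := mul_nonneg hβ0 ENNReal.toReal_nonneg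
  refine (measure_le_smul_volume_of_Ioc_le
    (C := ENNReal.ofReal (βstar * (ξ (Ici 0)).toReal)) ENNReal.ofReal_ne_top
    fun a b => ?_).absolutelyContinuous.trans Measure.smul_absolutelyContinuous
  rw [Measure.restrict_apply measurableSet_Ioc, Ioc_inter_Ioi, ← ENNReal.ofReal_mul hC]
  rcases le_or_gt b (max a 0) with hb | hb
  · simp [Ioc_eq_empty_of_le hb]
  · rw [← ENNReal.ofReal_toReal (measure_ne_top ξ (Ioc (max a 0) b))]
    refine ENNReal.ofReal_le_ofReal ((hlip _ b (le_max_right _ _) hb).trans ?_)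
    rw [mul_right_comm]
    exact mul_le_mul_of_nonneg_left (sub_le_sub_left (le_max_left _ _) b) hC
end

section
/- Let β : [0,∞) → ℝ be a bounded Borel measurable function and g : [0,∞) → ℝ a Lebesgue integrable function satisfying g(x) + ∫_{(x,∞)} β(u)·g(u) du = 0 for every x ≥ 0. Then g(x) = g(0)·exp(∫₀ˣ β(u) du) for every x ≥ 0. -/
open MeasureTheory Set

/-- A Lipschitz function composed with an absolutely continuous function is absolutely
continuous. -/
theorem LipschitzOnWith.comp_absolutelyContinuousOnInterval {X Y : Type*} [PseudoMetricSpace X]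
    [PseudoMetricSpace Y] {φ : X → Y} {f : ℝ → X} {K : NNReal} {a b : ℝ} {s : Set X}
    (hφ : LipschitzOnWith K φ s) (hf : AbsolutelyContinuousOnInterval f a b)
    (hfs : MapsTo f (uIcc a b) s) :
    AbsolutelyContinuousOnInterval (φ ∘ f) a b := by
  apply squeeze_zero' ?_ ?_ (by simpa using Filter.Tendsto.const_mul (K : ℝ) hf)
  · exact Filter.Eventually.of_forall fun _ ↦ Finset.sum_nonneg fun _ _ ↦ dist_nonneg
  rw [Filter.eventually_inf_principal]
  filter_upwards with E hE
  rw [Finset.mul_sum]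
  exact Finset.sum_le_sum fun i hi ↦
    hφ.dist_le_mul _ (hfs (hE.1 i hi).1) _ (hfs (hE.1 i hi).2)

theorem AbsolutelyContinuousOnInterval.exp {f : ℝ → ℝ} {a b : ℝ}
    (hf : AbsolutelyContinuousOnInterval f a b) :
    AbsolutelyContinuousOnInterval (fun x ↦ Real.exp (f x)) a b := by
  obtain ⟨C, hC⟩ := hf.exists_bound
  obtain ⟨K, hK⟩ := (Real.contDiff_exp (n := 1)).contDiffOn.exists_lipschitzOnWith
    one_ne_zero (convex_Icc (-C) C) isCompact_Icc
  exact hK.comp_absolutelyContinuousOnInterval hf fun x hx ↦ abs_le.mp (hC x hx)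

/-- Uniqueness for the linear integral equation `g(y) = g(a) + ∫ₐʸ β g`. -/
theorem eq_mul_exp_integral_of_eq_add_integral {β g : ℝ → ℝ} {a b : ℝ}
    (hβ : IntervalIntegrable β volume a b)
    (hβg : IntervalIntegrable (fun u ↦ β u * g u) volume a b)
    (hg : ∀ y ∈ uIcc a b, g y = g a + ∫ u in a..y, β u * g u) :
    g b = g a * Real.exp (∫ u in a..b, β u) := by
  have hconst : AbsolutelyContinuousOnInterval (fun _ : ℝ ↦ g a) a b :=
    (LipschitzWith.const (g a)).lipschitzOnWith.absolutelyContinuousOnInterval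
  have hac : AbsolutelyContinuousOnInterval
      (fun y ↦ (g a + ∫ u in a..y, β u * g u) * Real.exp (-∫ u in a..y, β u)) a b :=
    (hconst.add (hβg.absolutelyContinuousOnInterval_intervalIntegral left_mem_uIcc)).mul
      (hβ.absolutelyContinuousOnInterval_intervalIntegral left_mem_uIcc).neg.exp
  obtain ⟨C, hC⟩ := hac.const_of_ae_hasDerivAt_zero (by
    filter_upwards [hβ.ae_hasDerivAt_integral, hβg.ae_hasDerivAt_integral] with y h₁ h₂ hy
    convert! ((h₂ hy a left_mem_uIcc).const_add (g a)).mul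
      (h₁ hy a left_mem_uIcc).neg.exp using 1
    rw [← hg y hy]
    simp only [Pi.neg_apply]
    ring)
  have ha := hC a left_mem_uIcc
  have hb := hC b right_mem_uIcc
  simp only [intervalIntegral.integral_same, add_zero, neg_zero, Real.exp_zero, mul_one] at ha
  rw [← hg b right_mem_uIcc, ← ha, Real.exp_neg] at hb
  rw [← hb, inv_mul_cancel_right₀ (Real.exp_ne_zero _)]

/-- Equations (5.9)–(5.10) in the proof of Theorem 3.2: the integral equation
`g(x) + ∫_{(x,∞)} β g du = 0` forces `g(x) = g(0) exp(∫₀ˣ β)`. -/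
theorem stmt11
    (β g : ℝ → ℝ) (hβ_meas : Measurable β)
    (hβ_bdd : ∃ M : ℝ, ∀ u : ℝ, 0 ≤ u → |β u| ≤ M)
    (hg_meas : Measurable g)
    (hg_int : IntegrableOn g (Ici 0))
    (heq : ∀ x : ℝ, 0 ≤ x → g x + ∫ u in Ioi x, β u * g u = 0) :
    ∀ x : ℝ, 0 ≤ x → g x = g 0 * Real.exp (∫ u in Icc 0 x, β u) := by
  intro x hx
  obtain ⟨M, hM⟩ := hβ_bdd
  have hβg : IntegrableOn (fun u ↦ β u * g u) (Ici 0) :=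
    hg_int.bdd_mul hβ_meas.aestronglyMeasurable
      ((ae_restrict_mem measurableSet_Ici).mono hM)
  have hβ : IntegrableOn β (Ioc 0 x) :=
    Measure.integrableOn_of_bounded measure_Ioc_lt_top.ne hβ_meas.aestronglyMeasurable
      ((ae_restrict_mem measurableSet_Ioc).mono fun u hu ↦ hM u hu.1.le)
  rw [integral_Icc_eq_integral_Ioc, ← intervalIntegral.integral_of_le hx]
  refine eq_mul_exp_integral_of_eq_add_integral
    ((intervalIntegrable_iff_integrableOn_Ioc_of_le hx).2 hβ)
    ((intervalIntegrable_iff_integrableOn_Ioc_of_le hx).2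
      (hβg.mono_set fun u hu ↦ hu.1.le)) fun y hy ↦ ?_
  rw [uIcc_of_le hx] at hy
  have hsub := intervalIntegral.integral_Ioi_sub_Ioi (hβg.mono_set Ioi_subset_Ici_self) hy.1
  linarith [heq 0 le_rfl, heq y hy.1]
end

section
/- Let b : [0,∞) → ℝ be a bounded Borel measurable function with lim_{u→∞} b(u) = b_∞ ∈ ℝ, let σ² : [0,∞) → ℝ be Borel measurable with 0 < c₁ ≤ σ²(u) ≤ c₂ < ∞ for all u and some constants c₁, c₂, and set β(u) = 2 b(u)/σ²(u). Define C = ∫₀^∞ (1/σ²(u))·exp(∫₀ᵘ β(v) dv) du. Then: (a) if b_∞ < 0 then C < ∞; (b) if b_∞ > 0 then C = ∞. -/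
open MeasureTheory Filter Set

/-- If `|β| ≤ K` on `[0, ∞)` and `β ≤ -k` on `[T, ∞)`, then the primitive of `β` is bounded above
by an affine function of slope `-k`. -/
lemma setIntegral_Icc_le_of_eventually_le_neg {β : ℝ → ℝ} (hβ : Measurable β) {K k T : ℝ}
    (hT : 0 ≤ T) (hk : 0 ≤ k) (hK : ∀ v, 0 ≤ v → |β v| ≤ K) (hβT : ∀ v, T ≤ v → β v ≤ -k)
    {u : ℝ} (hu : 0 ≤ u) :
    ∫ v in Icc (0:ℝ) u, β v ≤ (K + k) * T - k * u := by
  have hK0 : 0 ≤ K := (abs_nonneg _).trans (hK 0 le_rfl)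
  have hint : IntegrableOn β (Icc 0 u) := by
    refine Measure.integrableOn_of_bounded (M := K) (by simp) hβ.aestronglyMeasurable ?_
    filter_upwards [ae_restrict_mem measurableSet_Icc] with v hv
    exact hK v hv.1
  have hind : IntegrableOn ((Icc (0:ℝ) T).indicator fun _ => K + k) (Icc 0 u) :=
    (integrableOn_const (by simp)).indicator measurableSet_Icc
  have hconst : IntegrableOn (fun _ : ℝ => k) (Icc 0 u) := integrableOn_const (by simp)
  have hle : ∫ v in Icc (0:ℝ) u, β v ≤
      ∫ v in Icc (0:ℝ) u, ((Icc (0:ℝ) T).indicator (fun _ => K + k) v - k) := by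
    refine setIntegral_mono_on hint (hind.sub hconst) measurableSet_Icc fun v hv => ?_
    by_cases hvT : v ≤ T
    · rw [indicator_of_mem (show v ∈ Icc 0 T from ⟨hv.1, hvT⟩)]
      linarith [(abs_le.mp (hK v hv.1)).2]
    · rw [indicator_of_notMem (fun h => hvT h.2)]
      linarith [hβT v (not_le.mp hvT).le]
  refine hle.trans ?_
  rw [integral_sub hind hconst, setIntegral_indicator measurableSet_Icc, Icc_inter_Icc]
  simp only [setIntegral_const, smul_eq_mul, Real.volume_real_Icc, max_self, sub_zero,
    max_eq_left hu]
  have hmin : max (min u T) 0 ≤ T := max_le (min_le_right _ _) hT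
  nlinarith [mul_le_mul_of_nonneg_right hmin (add_nonneg hK0 hk)]

/-- With a negative limiting drift, the primitive of `2b/σ²` tends to `-∞` at least linearly. -/
lemma exists_setIntegral_Icc_drift_le {b σ2 : ℝ → ℝ} (hb_meas : Measurable b)
    (hσ2_meas : Measurable σ2) (hb_bdd : ∃ M : ℝ, ∀ u : ℝ, 0 ≤ u → |b u| ≤ M)
    {binf : ℝ} (hb_lim : Tendsto b atTop (nhds binf)) {c₁ c₂ : ℝ} (hc₁ : 0 < c₁)
    (hσ2 : ∀ u : ℝ, 0 ≤ u → c₁ ≤ σ2 u ∧ σ2 u ≤ c₂) (hbinf : binf < 0) :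
    ∃ k D : ℝ, 0 < k ∧ ∀ u : ℝ, 0 ≤ u →
      ∫ v in Icc (0:ℝ) u, 2 * b v / σ2 v ≤ D - k * u := by
  obtain ⟨M, hM⟩ := hb_bdd
  have hc₂ : 0 < c₂ := hc₁.trans_le ((hσ2 0 le_rfl).1.trans (hσ2 0 le_rfl).2)
  obtain ⟨T₀, hT₀⟩ := eventually_atTop.mp
    (hb_lim.eventually_le_const (show binf < binf / 2 by linarith))
  have hk : 0 < -binf / c₂ := div_pos (neg_pos.mpr hbinf) hc₂
  refine ⟨-binf / c₂, (2 * M / c₁ + -binf / c₂) * max T₀ 0, hk, fun u hu => ?_⟩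
  refine setIntegral_Icc_le_of_eventually_le_neg (by fun_prop) (le_max_right _ _) hk.le
    (fun v hv => ?_) (fun v hv => ?_) hu
  · have hσ := (hσ2 v hv).1
    rw [abs_div, abs_mul, abs_two, abs_of_pos (hc₁.trans_le hσ)]
    have := hM v hv
    have : 0 ≤ M := (abs_nonneg _).trans this
    gcongr
  · have hσ := hσ2 v ((le_max_right _ _).trans hv)
    have hbv := hT₀ v ((le_max_left _ _).trans hv)
    have hσ0 := hc₁.trans_le hσ.1
    rw [← neg_div, neg_neg, div_le_div_iff₀ hσ0 hc₂]
    nlinarith [mul_le_mul_of_nonneg_left hσ.2 (neg_nonneg.mpr hbinf.le),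
      mul_le_mul_of_nonneg_right hbv hc₂.le]

/-- Equation (5.11) in the proof of Theorem 3.2: with `β = 2b/σ²`, the normalizing
constant `C = ∫₀^∞ (1/σ²(u)) exp(∫₀ᵘ β) du` is finite if `b_∞ < 0` and infinite if
`b_∞ > 0`. -/
theorem stmt12
    (b σ2 : ℝ → ℝ) (hb_meas : Measurable b) (hσ2_meas : Measurable σ2)
    (hb_bdd : ∃ M : ℝ, ∀ u : ℝ, 0 ≤ u → |b u| ≤ M)
    (binf : ℝ) (hb_lim : Tendsto b atTop (nhds binf))
    (c₁ c₂ : ℝ) (hc₁ : 0 < c₁)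
    (hσ2 : ∀ u : ℝ, 0 ≤ u → c₁ ≤ σ2 u ∧ σ2 u ≤ c₂) :
    (binf < 0 →
      (∫⁻ u in Ici (0:ℝ),
        ENNReal.ofReal (1 / σ2 u * Real.exp (∫ v in Icc (0:ℝ) u, 2 * b v / σ2 v))) < ⊤) ∧
    (0 < binf →
      (∫⁻ u in Ici (0:ℝ),
        ENNReal.ofReal (1 / σ2 u * Real.exp (∫ v in Icc (0:ℝ) u, 2 * b v / σ2 v))) = ⊤) := by
  have hc₂ : 0 < c₂ := hc₁.trans_le ((hσ2 0 le_rfl).1.trans (hσ2 0 le_rfl).2)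
  refine ⟨fun hbinf => ?_, fun hbinf => ?_⟩
  · obtain ⟨k, D, hk, hD⟩ :=
      exists_setIntegral_Icc_drift_le hb_meas hσ2_meas hb_bdd hb_lim hc₁ hσ2 hbinf
    have hint : IntegrableOn (fun u => 1 / c₁ * Real.exp D * Real.exp (-k * u)) (Ici (0:ℝ)) :=
      Integrable.const_mul ((exp_neg_integrableOn_Ioi 0 hk).congr_set_ae Ioi_ae_eq_Ici.symm) _
    refine lt_of_le_of_lt (setLIntegral_mono' measurableSet_Ici fun u hu => ?_)
      hint.lintegral_lt_top
    refine ENNReal.ofReal_le_ofReal ?_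
    have hexp : Real.exp D * Real.exp (-k * u) = Real.exp (D - k * u) := by
      rw [← Real.exp_add]; ring_nf
    rw [mul_assoc, hexp]
    have := hD u hu
    have := (hσ2 u hu).1
    gcongr
  · obtain ⟨k, D, hk, hD⟩ :=
      exists_setIntegral_Icc_drift_le (b := fun u => -b u) hb_meas.neg hσ2_meas
        (by simpa using hb_bdd) hb_lim.neg hc₁ hσ2 (neg_neg_of_pos hbinf)
    have hpos : 0 < 1 / c₂ * Real.exp (-D) := by positivity
    have hconst : ∫⁻ _ in Ici (0:ℝ), ENNReal.ofReal (1 / c₂ * Real.exp (-D)) = ⊤ := by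
      rw [setLIntegral_const, Real.volume_Ici]
      exact ENNReal.mul_top (ENNReal.ofReal_pos.mpr hpos).ne'
    refine top_le_iff.mp (hconst.ge.trans ?_)
    refine setLIntegral_mono' measurableSet_Ici fun u hu => ENNReal.ofReal_le_ofReal ?_
    have hDu := hD u hu
    simp only [mul_neg, neg_div, integral_neg] at hDu
    have hexp : -D ≤ ∫ v in Icc (0:ℝ) u, 2 * b v / σ2 v := by
      linarith [mul_nonneg hk.le (mem_Ici.mp hu)]
    have hσ := hσ2 u hu
    have hσ0 := hc₁.trans_le hσ.1
    have := hσ.2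
    gcongr
end
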